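/- For every δ ∈ (0,1] there exists τ₀ > 0 such that for all τ, ν with 0 < ν ≤ τ ≤ τ₀ there exists n₀ ∈ ℕ such that the following holds for every even n ≥ n₀: let G be a robust (ν,τ)-expander on n vertices in which every vertex has degree exactly δn, let N be a matching in G, and for each non-negative integer j let M_j denote the set of perfect matchings of G containing exactly j edges of N. Then for every integer k with 1 ≤ k ≤ min{|N|, n^{1/3}}, the set M_{k−1} is nonempty and (1 − n^{−1/7})·(|N|−k+1)/(kδn) ≤ |M_k|/|M_{k−1}| ≤ (1 + n^{−1/7})·(|N|−k+1)/(kδn). -/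

import Mathlib

open Finset

namespace RPM

/-- The `ν`-robust neighbourhood of a vertex set `S` in a graph `G` on `n` vertices:
all vertices having at least `ν * n` neighbours in `S`. -/
def RN {V : Type*} [Fintype V] (G : SimpleGraph V) (ν : ℝ) (S : Set V) : Set V :=
  {v : V | ν * (Fintype.card V : ℝ) ≤ (Nat.card {u : V | u ∈ S ∧ G.Adj v u} : ℝ)}

/-- `G` is a robust `(ν, τ)`-expander. -/
def RobustExpander {V : Type*} [Fintype V] (G : SimpleGraph V) (ν τ : ℝ) : Prop :=
  ∀ S : Set V,
    τ * (Fintype.card V : ℝ) ≤ (Nat.card S : ℝ) →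
    (Nat.card S : ℝ) ≤ (1 - τ) * (Fintype.card V : ℝ) →
    (Nat.card S : ℝ) + ν * (Fintype.card V : ℝ) ≤ (Nat.card (RN G ν S) : ℝ)

/-- `M` (a set of edges) is a perfect matching of `G`: its edges are edges of `G`,
and every vertex lies in exactly one edge of `M` (in particular the edges are
pairwise disjoint and cover all vertices). -/
def IsPM {V : Type*} (G : SimpleGraph V) (M : Finset (Sym2 V)) : Prop :=
  (∀ e ∈ M, e ∈ G.edgeSet) ∧ ∀ v : V, ∃! e, e ∈ M ∧ v ∈ e

/-- The number of perfect matchings of `G`. -/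
noncomputable def pmCount {V : Type*} (G : SimpleGraph V) : ℕ :=
  Nat.card {M : Finset (Sym2 V) // IsPM G M}

/-- `N` (a set of edges) is a matching in `G`: edges of `G`, pairwise disjoint. -/
def IsMatchingIn {V : Type*} (G : SimpleGraph V) (N : Finset (Sym2 V)) : Prop :=
  (∀ e ∈ N, e ∈ G.edgeSet) ∧ ∀ e ∈ N, ∀ f ∈ N, e ≠ f → ∀ v : V, v ∈ e → v ∉ f

/-- `G` is `d`-regular: every vertex has exactly `d` neighbours. -/
def RegularDeg {V : Type*} (G : SimpleGraph V) (d : ℕ) : Prop :=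
  ∀ v : V, Nat.card {u : V | G.Adj v u} = d

/-- Probability that a uniformly random perfect matching of `G` contains the edge `e`. -/
noncomputable def edgeProb {V : Type*} (G : SimpleGraph V) (e : Sym2 V) : ℝ :=
  (Nat.card {M : Finset (Sym2 V) // IsPM G M ∧ e ∈ M} : ℝ) / (pmCount G : ℝ)

/-- `P[X = k]` where `X = |M ∩ N|` for a uniformly random perfect matching `M` of `G`. -/
noncomputable def interProb {V : Type*} [DecidableEq V] (G : SimpleGraph V)
    (N : Finset (Sym2 V)) (k : ℕ) : ℝ :=
  (Nat.card {M : Finset (Sym2 V) // IsPM G M ∧ (M ∩ N).card = k} : ℝ) / (pmCount G : ℝ)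

/-- The Poisson probability mass function with parameter `lam`. -/
noncomputable def poissonPMF (lam : ℝ) (k : ℕ) : ℝ :=
  Real.exp (-lam) * lam ^ k / (Nat.factorial k)

/-- The number of perfect matchings of `G` containing exactly `j` edges of `N`. -/
noncomputable def pmCountInter {V : Type*} [DecidableEq V] (G : SimpleGraph V)
    (N : Finset (Sym2 V)) (j : ℕ) : ℕ :=
  Nat.card {M : Finset (Sym2 V) // IsPM G M ∧ (M ∩ N).card = j}

open scoped Classical in
/-- If every coordinate of a family of functions takes at most `b i` values once the earlier
coordinates are fixed, then the family has at most `∏ i, b i` members. -/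
theorem card_le_prod_of_prefix {V : Type*} [Fintype V] : ∀ (m : ℕ) (S : Finset (Fin m → V))
    (b : Fin m → ℕ)
    (_ : ∀ (i : Fin m) (p : Fin m → V),
      #{a | ∃ f ∈ S, (∀ j < i, f j = p j) ∧ f i = a} ≤ b i),
    #S ≤ ∏ i, b i := by
  intro m
  induction m with
  | zero =>
    intro S b _
    simpa using Finset.card_le_one_of_subsingleton S
  | succ m ih =>
    intro S b h
    have h1 : #S ≤ b (Fin.last m) * #(S.image Fin.init) := by
      refine Finset.card_le_mul_card_image S _ ?_
      intro p hp
      obtain ⟨f₀, hf₀, rfl⟩ := Finset.mem_image.1 hp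
      refine le_trans ?_ (h (Fin.last m) f₀)
      refine Finset.card_le_card_of_injOn (fun f => f (Fin.last m)) ?_ ?_
      · intro f hf
        simp only [coe_filter, Set.mem_ofPred_eq] at hf
        simp only [coe_filter, mem_univ, true_and, Set.mem_ofPred_eq]
        refine ⟨f, hf.1, ?_, rfl⟩
        intro j hj
        have := congrFun hf.2 (j.castPred hj.ne)
        simpa [Fin.init] using this
      · intro f hf g hg hfg
        simp only [coe_filter, Set.mem_ofPred_eq] at hf hg
        rw [← Fin.snoc_init_self f, ← Fin.snoc_init_self g, hf.2, hg.2]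
        simp only at hfg
        rw [hfg]
    have h2 : #(S.image Fin.init) ≤ ∏ i : Fin m, b i.castSucc := by
      refine ih _ _ ?_
      intro i p
      rcases (S.image Fin.init).eq_empty_or_nonempty with h0 | ⟨q, hq⟩
      · simp [h0]
      refine le_trans (Finset.card_le_card ?_)
        (h i.castSucc (Fin.snoc p (q i) : Fin (m + 1) → V))
      intro a ha
      simp only [mem_filter, mem_univ, true_and, mem_image] at ha ⊢
      obtain ⟨f, ⟨g, hg, rfl⟩, h3, h4⟩ := ha
      refine ⟨g, hg, ?_, h4⟩
      intro j hj
      have hjl : j ≠ Fin.last m := (hj.trans (Fin.castSucc_lt_last i)).ne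
      obtain ⟨j', rfl⟩ : ∃ j' : Fin m, j = j'.castSucc := ⟨j.castPred hjl, by simp⟩
      have := h3 j' (by simpa using hj)
      simpa [Fin.init] using this
    rw [Fin.prod_univ_castSucc, mul_comm]
    exact h1.trans (Nat.mul_le_mul_left _ h2)

section Walks

open scoped Classical

variable {V : Type*} [Fintype V]

/-- Sequences of length `m + 1` from `x` to `z` in which each step goes along an edge of `G` and
then along `σ`. -/
noncomputable def walks (G : SimpleGraph V) (σ : Equiv.Perm V) (m : ℕ) (x z : V) :
    Finset (Fin (m + 1) → V) :=
  {f | f 0 = x ∧ f (Fin.last m) = z ∧ ∀ i : Fin m, G.Adj (f i.castSucc) (σ (f i.succ))}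

theorem card_walks_zero (G : SimpleGraph V) (σ : Equiv.Perm V) (x z : V) :
    #(walks G σ 0 x z) = if x = z then 1 else 0 := by
  split_ifs with h
  · subst h
    rw [Finset.card_eq_one]
    refine ⟨fun _ => x, ?_⟩
    ext f
    simp only [walks, mem_filter, mem_univ, true_and, mem_singleton]
    constructor
    · rintro ⟨h, -⟩
      funext i
      rw [show i = 0 from Fin.ext (by omega), h]
    · rintro rfl
      exact ⟨rfl, rfl, fun i => i.elim0⟩
  · rw [Finset.card_eq_zero, Finset.eq_empty_iff_forall_notMem]
    intro f hf
    simp only [walks, mem_filter, mem_univ, true_and] at hf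
    exact h (hf.1.symm.trans hf.2.1)

theorem card_walks_succ (G : SimpleGraph V) (σ : Equiv.Perm V) (m : ℕ) (x z : V) :
    #(walks G σ (m + 1) x z) = ∑ y with G.Adj x (σ y), #(walks G σ m y z) := by
  rw [← Finset.card_sigma]
  refine Finset.card_nbij' (fun f => ⟨f 1, Fin.tail f⟩) (fun p => Fin.cons x p.2) ?_ ?_ ?_ ?_
  · intro f hf
    simp only [walks, coe_filter, mem_univ, true_and, Set.mem_ofPred_eq] at hf
    obtain ⟨h0, h1, h2⟩ := hf
    simp only [coe_sigma, Set.mem_sigma_iff, coe_filter, mem_univ, true_and, Set.mem_ofPred_eq,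
      walks, Fin.tail]
    refine ⟨?_, rfl, ?_, ?_⟩
    · have := h2 0
      simpa [h0] using this
    · simpa using h1
    · intro i
      simpa using h2 i.succ
  · rintro ⟨y, g⟩ hg
    simp only [coe_sigma, Set.mem_sigma_iff, coe_filter, mem_univ, true_and, Set.mem_ofPred_eq,
      walks] at hg
    obtain ⟨hxy, h0, h1, h2⟩ := hg
    simp only [walks, coe_filter, mem_univ, true_and, Set.mem_ofPred_eq]
    refine ⟨by simp, ?_, ?_⟩
    · rw [← Fin.succ_last, Fin.cons_succ, h1]
    · intro i
      refine Fin.cases ?_ (fun j => ?_) i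
      · simpa [h0] using hxy
      · simpa using h2 j
  · intro f hf
    simp only [walks, coe_filter, mem_univ, true_and, Set.mem_ofPred_eq] at hf
    simp only [← hf.1, Fin.cons_self_tail]
  · rintro ⟨y, g⟩ hg
    simp only [coe_sigma, Set.mem_sigma_iff, coe_filter, mem_univ, true_and, Set.mem_ofPred_eq,
      walks] at hg
    obtain ⟨hxy, h0, h1, h2⟩ := hg
    simp only [Fin.tail_cons, Sigma.mk.injEq, heq_eq_eq, and_true]
    rw [← h0]; rfl

theorem card_adj_perm {G : SimpleGraph V} {d : ℕ} (hd : ∀ x, #{y | G.Adj x y} = d)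
    (σ : Equiv.Perm V) (x : V) : #{y | G.Adj x (σ y)} = d := by
  rw [← hd x]
  refine Finset.card_bij' (fun y _ => σ y) (fun y _ => σ.symm y) ?_ ?_ ?_ ?_ <;> simp

theorem sum_card_walks_right {G : SimpleGraph V} {d : ℕ} (hd : ∀ x, #{y | G.Adj x y} = d)
    (σ : Equiv.Perm V) (m : ℕ) (x : V) : ∑ z, #(walks G σ m x z) = d ^ m := by
  induction m generalizing x with
  | zero => simp [card_walks_zero]
  | succ m ih =>
    simp only [card_walks_succ]
    rw [Finset.sum_comm]
    simp only [ih, Finset.sum_const, smul_eq_mul, card_adj_perm hd, pow_succ']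

theorem sum_card_walks_left {G : SimpleGraph V} {d : ℕ} (hd : ∀ x, #{y | G.Adj x y} = d)
    (σ : Equiv.Perm V) (m : ℕ) (z : V) : ∑ x, #(walks G σ m x z) = d ^ m := by
  induction m with
  | zero => simp [card_walks_zero]
  | succ m ih =>
    simp only [card_walks_succ, Finset.sum_filter]
    rw [Finset.sum_comm]
    simp only [← Finset.sum_filter, Finset.sum_const, smul_eq_mul, G.adj_comm _ (σ _), hd,
      ← Finset.mul_sum, ih, pow_succ']

theorem card_walks_add (G : SimpleGraph V) (σ : Equiv.Perm V) (l m : ℕ) (x z : V) :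
    #(walks G σ (l + m) x z) = ∑ y, #(walks G σ l x y) * #(walks G σ m y z) := by
  induction l generalizing x with
  | zero =>
    rw [zero_add]
    simp [card_walks_zero]
  | succ l ih =>
    rw [show l + 1 + m = l + m + 1 by ring]
    simp only [card_walks_succ, ih, Finset.sum_mul]
    rw [Finset.sum_comm]

end Walks

section Mixing

open scoped Classical

variable {V : Type*} [Fintype V]

theorem RobustExpander.card_add_le {G : SimpleGraph V} {ν τ : ℝ} (h : RobustExpander G ν τ)
    (S : Finset V) (h1 : τ * Fintype.card V ≤ #S) (h2 : (#S : ℝ) ≤ (1 - τ) * Fintype.card V) :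
    (#S : ℝ) + ν * Fintype.card V ≤
      #{v | ν * (Fintype.card V : ℝ) ≤ #{u ∈ S | G.Adj v u}} := by
  have key := h (S : Set V)
  have hS : Nat.card (S : Set V) = #S := by simp
  have hin : ∀ v, Nat.card {u : V | u ∈ (S : Set V) ∧ G.Adj v u} = #{u ∈ S | G.Adj v u} := by
    intro v
    rw [← Nat.card_eq_finsetCard]
    refine Nat.card_congr (Equiv.subtypeEquivRight fun u => ?_)
    simp
  have hRN : Nat.card (RN G ν (S : Set V)) =
      #{v | ν * (Fintype.card V : ℝ) ≤ #{u ∈ S | G.Adj v u}} := by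
    rw [← Nat.card_eq_finsetCard]
    refine Nat.card_congr (Equiv.subtypeEquivRight fun v => ?_)
    simp only [RN, Set.mem_ofPred_eq, hin, mem_filter, mem_univ, true_and]
  rw [hS, hRN] at key
  exact key h1 h2

theorem pow_le_card_walks {G : SimpleGraph V} {ν τ : ℝ} (h : RobustExpander G ν τ) (hν : 0 < ν)
    (hτ : 0 < τ) {d : ℕ} (hd : ∀ x, #{y | G.Adj x y} = d) (hτd : (τ + ν) * Fintype.card V ≤ d)
    {l : ℕ} (hl : 1 ≤ l * ν) (σ : Equiv.Perm V) (x z : V) :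
    (ν * Fintype.card V) ^ (l + 1) ≤ (#(walks G σ (l + 2) x z) : ℝ) := by
  set n : ℝ := (Fintype.card V : ℝ) with hn
  have hn0 : 0 < n := by
    rw [hn]; exact_mod_cast Fintype.card_pos_iff.2 ⟨x⟩
  have hνn : 0 < ν * n := mul_pos hν hn0
  set S : ℕ → Finset V := fun i => {x | (ν * n) ^ i ≤ (#(walks G σ (i + 1) x z) : ℝ)} with hS
  have hstep : ∀ i v, ν * n ≤ #{u ∈ (S i).map σ.toEmbedding | G.Adj v u} → v ∈ S (i + 1) := by
    intro i v hv
    have e : #{u ∈ (S i).map σ.toEmbedding | G.Adj v u} = #{y ∈ S i | G.Adj v (σ y)} := by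
      rw [Finset.filter_map, Finset.card_map]; rfl
    rw [e] at hv
    simp only [hS, mem_filter, mem_univ, true_and]
    rw [card_walks_succ]
    push_cast
    calc (ν * n) ^ (i + 1) = (ν * n) * (ν * n) ^ i := by ring
      _ ≤ #{y ∈ S i | G.Adj v (σ y)} * (ν * n) ^ i := by gcongr
      _ = ∑ y ∈ S i with G.Adj v (σ y), (ν * n) ^ i := by simp
      _ ≤ ∑ y ∈ S i with G.Adj v (σ y), (#(walks G σ (i + 1) y z) : ℝ) := by
          refine Finset.sum_le_sum fun y hy => ?_
          simp only [hS, mem_filter, mem_univ, true_and] at hy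
          exact hy.1
      _ ≤ _ := by
          refine Finset.sum_le_sum_of_subset_of_nonneg ?_ fun _ _ _ => by positivity
          intro y hy
          simp only [mem_filter, mem_univ, true_and] at hy ⊢
          exact hy.2
  have hbig : ∀ i, (1 - τ) * n < #(S i) → S (i + 1) = univ := by
    intro i hi
    refine Finset.eq_univ_of_forall fun v => hstep i v ?_
    have h1 : #{u | G.Adj v u} ≤
        #{u ∈ (S i).map σ.toEmbedding | G.Adj v u} + #((S i).map σ.toEmbedding)ᶜ := by
      refine le_trans (Finset.card_le_card ?_) (Finset.card_union_le _ _)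
      intro u hu
      simp only [mem_filter, mem_univ, true_and] at hu
      by_cases hus : u ∈ (S i).map σ.toEmbedding
      · exact Finset.mem_union_left _ (Finset.mem_filter.2 ⟨hus, hu⟩)
      · exact Finset.mem_union_right _ (Finset.mem_compl.2 hus)
    have h2 : (#((S i).map σ.toEmbedding)ᶜ : ℝ) + #(S i) = n := by
      rw [hn, ← Finset.card_compl_add_card ((S i).map σ.toEmbedding), Finset.card_map]
      push_cast; rfl
    rw [hd v] at h1
    have h3 : (d : ℝ) ≤ #{u ∈ (S i).map σ.toEmbedding | G.Adj v u} +
      #((S i).map σ.toEmbedding)ᶜ := by exact_mod_cast h1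
    linarith
  have hgrow : ∀ i : ℕ, (τ + i * ν) * n ≤ #(S i) ∨ (1 - τ) * n < #(S i) := by
    intro i
    induction i with
    | zero =>
      left
      have : #{x | G.Adj (σ z) x} ≤ #(S 0) := by
        refine Finset.card_le_card fun v hv => ?_
        simp only [hS, mem_filter, mem_univ, true_and, pow_zero] at hv ⊢
        rw [card_walks_succ]
        push_cast
        simp only [card_walks_zero]
        have : z ∈ ({y | G.Adj v (σ y)} : Finset V) := by simp [hv.symm]
        have := Finset.single_le_sum (f := fun y => (((if y = z then 1 else 0 : ℕ)) : ℝ))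
          (fun _ _ => by positivity) this
        simpa using this
      rw [hd] at this
      have h3 : (d : ℝ) ≤ #(S 0) := by exact_mod_cast this
      push_cast
      nlinarith
    | succ i ih =>
      by_cases hi : (1 - τ) * n < #(S i)
      · right
        rw [hbig i hi, Finset.card_univ, ← hn]
        nlinarith
      · have ih' := ih.resolve_right hi
        left
        push Not at hi
        have h1 := h.card_add_le ((S i).map σ.toEmbedding)
          (by
            rw [Finset.card_map]
            refine le_trans ?_ ih'
            gcongr
            nlinarith [i.cast_nonneg (α := ℝ)])
          (by rw [Finset.card_map]; exact hi)
        rw [Finset.card_map] at h1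
        have h2 : #{v | ν * (Fintype.card V : ℝ) ≤ #{u ∈ (S i).map σ.toEmbedding | G.Adj v u}} ≤
            #(S (i + 1)) := by
          refine Finset.card_le_card fun v hv => hstep i v ?_
          simpa using hv
        have h3 :
            (#{v | ν * (Fintype.card V : ℝ) ≤ #{u ∈ (S i).map σ.toEmbedding | G.Adj v u}} : ℝ) ≤
            #(S (i + 1)) := by exact_mod_cast h2
        push_cast
        linarith
  have hlast : (1 - τ) * n < #(S l) := by
    rcases hgrow l with h1 | h1
    · refine lt_of_lt_of_le ?_ h1
      gcongr
      linarith
    · exact h1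
  have hx : x ∈ S (l + 1) := by
    rw [hbig l hlast]
    exact Finset.mem_univ x
  simpa only [hS, mem_filter, mem_univ, true_and] using hx

theorem abs_card_walks_sub_le {G : SimpleGraph V} {σ : Equiv.Perm V} {d : ℕ}
    (hd : ∀ x, #{y | G.Adj x y} = d) {L : ℕ} {η : ℝ}
    (hη : ∀ x z, η * d ^ L / Fintype.card V ≤ (#(walks G σ L x z) : ℝ)) (q : ℕ) (x z : V) :
    |(#(walks G σ (L * q) x z) : ℝ) - d ^ (L * q) / Fintype.card V| ≤
      (1 - η) ^ q * d ^ (L * q) := by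
  have hn1 : (1 : ℝ) ≤ Fintype.card V := by exact_mod_cast Fintype.card_pos_iff.2 ⟨x⟩
  have hn0 : (0 : ℝ) < Fintype.card V := by linarith
  induction q generalizing x with
  | zero =>
    rw [mul_zero, card_walks_zero]
    simp only [pow_zero, mul_one]
    have h1 : 0 < 1 / (Fintype.card V : ℝ) := by positivity
    have h2 : 1 / (Fintype.card V : ℝ) ≤ 1 := by rw [div_le_one hn0]; exact hn1
    split_ifs <;> rw [abs_le] <;> constructor <;> push_cast <;> linarith
  | succ q ih =>
    set m := L * q with hm
    rw [show L * (q + 1) = L + m by rw [hm]; ring, card_walks_add]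
    push_cast
    set n : ℝ := (Fintype.card V : ℝ) with hn
    set c : ℝ := η * d ^ L / n with hc
    set r : ℝ := (1 - η) ^ q with hr
    have hcol : ∑ y, (#(walks G σ m y z) : ℝ) = d ^ m := by
      exact_mod_cast sum_card_walks_left hd σ m z
    have hrow : ∑ y, (#(walks G σ L x y) : ℝ) = d ^ L := by
      exact_mod_cast sum_card_walks_right hd σ L x
    have hrow' : ∑ y, ((#(walks G σ L x y) : ℝ) - c) = (1 - η) * d ^ L := by
      rw [Finset.sum_sub_distrib, hrow, Finset.sum_const, Finset.card_univ, nsmul_eq_mul, ← hn, hc]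
      field_simp
    have e : ∑ y, (#(walks G σ L x y) : ℝ) * #(walks G σ m y z) - d ^ (L + m) / n =
        ∑ y, ((#(walks G σ L x y) : ℝ) - c) * (#(walks G σ m y z) - d ^ m / n) := by
      simp only [mul_sub, sub_mul, Finset.sum_sub_distrib, ← Finset.mul_sum, ← Finset.sum_mul,
        hcol, hrow, Finset.sum_const, Finset.card_univ, nsmul_eq_mul, ← hn]
      field_simp
      ring
    rw [e]
    calc _ ≤ ∑ y, |((#(walks G σ L x y) : ℝ) - c) * (#(walks G σ m y z) - d ^ m / n)| :=
          Finset.abs_sum_le_sum_abs _ _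
      _ ≤ ∑ y, ((#(walks G σ L x y) : ℝ) - c) * (r * d ^ m) := by
          refine Finset.sum_le_sum fun y _ => ?_
          have : 0 ≤ (#(walks G σ L x y) : ℝ) - c := sub_nonneg.2 (hη x y)
          rw [abs_mul, abs_of_nonneg this]
          exact mul_le_mul_of_nonneg_left (ih y) this
      _ = _ := by
          rw [← Finset.sum_mul, hrow']
          ring
end Mixing

section Clean

open scoped Classical

variable {V : Type*} [Fintype V]

/-- Steps of the walk `f` meet each pair `{v, σ v}` at most once, avoid `H`, and after the start
avoid `F`. -/
def IsClean (H : SimpleGraph V) (F : Finset V) (σ : Equiv.Perm V) {m : ℕ}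
    (f : Fin (m + 1) → V) : Prop :=
  (Function.Injective f ∧ ∀ i j, f i ≠ σ (f j)) ∧
    (∀ i : Fin m, ¬ H.Adj (f i.castSucc) (σ (f i.succ))) ∧ ∀ i ≠ 0, f i ∉ F

theorem card_le_of_subset_walks {G : SimpleGraph V} {σ : Equiv.Perm V} {d : ℕ}
    (hd : ∀ x, #{y | G.Adj x y} = d) {m : ℕ} {x z : V} {S : Finset (Fin (m + 1) → V)}
    (hS : S ⊆ walks G σ m x z) {i₀ : Fin (m + 1)} (h0 : i₀ ≠ 0) (hl : i₀ ≠ Fin.last m) {J : ℕ}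
    (hJ : ∀ p : Fin (m + 1) → V, #{a | ∃ f ∈ S, (∀ j < i₀, f j = p j) ∧ f i₀ = a} ≤ J) :
    #S ≤ J * d ^ (m - 2) := by
  set b : Fin (m + 1) → ℕ := fun i =>
    if i = i₀ then J else if i = 0 ∨ i = Fin.last m then 1 else d with hb
  have h0l : (0 : Fin (m + 1)) ≠ Fin.last m := by
    intro h
    have h1 : m = 0 := by simpa using (congrArg Fin.val h).symm
    subst h1
    exact h0 (Fin.ext (by omega))
  have hprod : ∏ i, b i = J * d ^ (m - 2) := by
    rw [← Finset.mul_prod_erase _ _ (Finset.mem_univ i₀)]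
    congr 1
    · simp [hb]
    have hsub : (univ.erase i₀ \ {0, Fin.last m}) ⊆ (univ.erase i₀ : Finset (Fin (m + 1))) :=
      Finset.sdiff_subset
    rw [← Finset.prod_subset hsub, Finset.prod_congr rfl (g := fun _ => d), Finset.prod_const,
      Finset.card_sdiff_of_subset, Finset.card_erase_of_mem (Finset.mem_univ _),
      Finset.card_pair h0l, Finset.card_univ, Fintype.card_fin, Nat.add_sub_cancel]
    · intro i hi
      simp only [mem_insert, mem_singleton] at hi
      rcases hi with rfl | rfl
      · simp [Ne.symm h0]
      · simp [Ne.symm hl]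
    · intro i hi
      simp only [mem_sdiff, mem_erase, mem_univ, and_true, mem_insert, mem_singleton] at hi
      simp [hb, hi.1, hi.2]
    · intro i hi hi'
      simp only [mem_sdiff, mem_erase, mem_univ, and_true, mem_insert, mem_singleton, not_and,
        not_not] at hi hi'
      simp only [hb, if_neg hi, if_pos (hi' hi)]
  rw [← hprod]
  refine card_le_prod_of_prefix _ S b ?_
  intro i p
  by_cases hi : i = i₀
  · subst hi
    simpa only [hb, if_true] using hJ p
  simp only [hb, if_neg hi]
  split_ifs with hi'
  · rw [Finset.card_le_one]
    intro a ha a' ha'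
    simp only [mem_filter, mem_univ, true_and] at ha ha'
    obtain ⟨f, hf, -, rfl⟩ := ha
    obtain ⟨g, hg, -, rfl⟩ := ha'
    have hf' := hS hf
    have hg' := hS hg
    simp only [walks, mem_filter, mem_univ, true_and] at hf' hg'
    rcases hi' with rfl | rfl
    · rw [hf'.1, hg'.1]
    · rw [hf'.2.1, hg'.2.1]
  · push Not at hi'
    obtain ⟨j, rfl⟩ : ∃ j : Fin m, i = j.succ := ⟨i.pred hi'.1, by simp⟩
    rw [← card_adj_perm hd σ (p j.castSucc)]
    refine Finset.card_le_card fun a ha => ?_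
    simp only [mem_filter, mem_univ, true_and] at ha ⊢
    obtain ⟨f, hf, hp, rfl⟩ := ha
    have hf' := hS hf
    simp only [walks, mem_filter, mem_univ, true_and] at hf'
    rw [← hp j.castSucc (Fin.castSucc_lt_succ)]
    exact hf'.2.2 j

theorem card_walks_filter_eq_le {G : SimpleGraph V} {σ : Equiv.Perm V} {d : ℕ}
    (hd : ∀ x, #{y | G.Adj x y} = d) {m : ℕ} {x z : V} (ρ : Equiv.Perm V)
    (hρ : x ≠ ρ z) {i j : Fin (m + 1)} (hij : i < j) :
    #{f ∈ walks G σ m x z | f i = ρ (f j)} ≤ 1 * d ^ (m - 2) := by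
  have hj0 : j ≠ 0 := fun h => by simp [h] at hij
  have hil : i ≠ Fin.last m := (hij.trans_le (Fin.le_last j)).ne
  by_cases hj : j = Fin.last m
  · subst hj
    by_cases hi : i = 0
    · subst hi
      rw [Finset.filter_false_of_mem]
      · simp
      · intro f hf
        simp only [walks, mem_filter, mem_univ, true_and] at hf
        rw [hf.1, hf.2.1]
        exact hρ
    · refine card_le_of_subset_walks hd (Finset.filter_subset _ _) hi hil fun p => ?_
      rw [Finset.card_le_one]
      intro a ha a' ha'
      simp only [walks, mem_filter, mem_univ, true_and] at ha ha'
      obtain ⟨f, ⟨⟨-, hf, -⟩, hf'⟩, -, rfl⟩ := ha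
      obtain ⟨g, ⟨⟨-, hg, -⟩, hg'⟩, -, rfl⟩ := ha'
      rw [hf', hg', hf, hg]
  · refine card_le_of_subset_walks hd (Finset.filter_subset _ _) hj0 hj fun p => ?_
    rw [Finset.card_le_one]
    intro a ha a' ha'
    simp only [mem_filter, mem_univ, true_and] at ha ha'
    obtain ⟨f, ⟨-, hf⟩, hp, rfl⟩ := ha
    obtain ⟨g, ⟨-, hg⟩, hq, rfl⟩ := ha'
    apply ρ.injective
    rw [← hf, ← hg, hp i hij, hq i hij]

theorem card_walks_filter_adj_le {G H : SimpleGraph V} {σ : Equiv.Perm V} {d : ℕ}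
    (hd : ∀ x, #{y | G.Adj x y} = d) (hH : ∀ a b c, H.Adj a b → H.Adj a c → b = c)
    {m : ℕ} (hm : 2 ≤ m) (x z : V) (i : Fin m) :
    #{f ∈ walks G σ m x z | H.Adj (f i.castSucc) (σ (f i.succ))} ≤ 1 * d ^ (m - 2) := by
  by_cases hi : i.succ = Fin.last m
  · have hi0 : i.castSucc ≠ 0 := by
      intro h
      have h1 := congrArg Fin.val hi
      have h2 := congrArg Fin.val h
      simp at h1 h2
      omega
    refine card_le_of_subset_walks hd (Finset.filter_subset _ _) hi0
      (Fin.castSucc_lt_last i).ne fun p => ?_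
    rw [Finset.card_le_one]
    intro a ha a' ha'
    simp only [hi, walks, mem_filter, mem_univ, true_and] at ha ha'
    obtain ⟨f, ⟨⟨-, hf, -⟩, hf'⟩, -, rfl⟩ := ha
    obtain ⟨g, ⟨⟨-, hg, -⟩, hg'⟩, -, rfl⟩ := ha'
    rw [hf] at hf'
    rw [hg] at hg'
    exact hH _ _ _ hf'.symm hg'.symm
  · refine card_le_of_subset_walks hd (Finset.filter_subset _ _) (Fin.succ_ne_zero i) hi fun p => ?_
    rw [Finset.card_le_one]
    intro a ha a' ha'
    simp only [mem_filter, mem_univ, true_and] at ha ha'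
    obtain ⟨f, ⟨-, hf⟩, hp, rfl⟩ := ha
    obtain ⟨g, ⟨-, hg⟩, hq, rfl⟩ := ha'
    rw [hp _ Fin.castSucc_lt_succ] at hf
    rw [hq _ Fin.castSucc_lt_succ] at hg
    exact σ.injective (hH _ _ _ hf hg)

theorem card_walks_filter_mem_le {G : SimpleGraph V} {σ : Equiv.Perm V} {d : ℕ}
    (hd : ∀ x, #{y | G.Adj x y} = d) {m : ℕ} (x : V) {z : V} {F : Finset V} (hz : z ∉ F)
    {i : Fin (m + 1)} (hi : i ≠ 0) :
    #{f ∈ walks G σ m x z | f i ∈ F} ≤ #F * d ^ (m - 2) := by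
  by_cases hl : i = Fin.last m
  · subst hl
    rw [Finset.filter_false_of_mem]
    · simp
    · intro f hf
      simp only [walks, mem_filter, mem_univ, true_and] at hf
      rw [hf.2.1]
      exact hz
  · refine card_le_of_subset_walks hd (Finset.filter_subset _ _) hi hl fun p => ?_
    refine Finset.card_le_card fun a ha => ?_
    simp only [mem_filter, mem_univ, true_and] at ha
    obtain ⟨f, ⟨-, hf⟩, -, rfl⟩ := ha
    exact hf

theorem card_walks_le_card_clean_add {G H : SimpleGraph V} {σ : Equiv.Perm V} {d : ℕ}
    (hd : ∀ x, #{y | G.Adj x y} = d) (hH : ∀ a b c, H.Adj a b → H.Adj a c → b = c)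
    (hσ : ∀ v, σ (σ v) = v) (hσ' : ∀ v, σ v ≠ v)
    {m : ℕ} (hm : 2 ≤ m) {x z : V} (hzx : z ≠ x) (hzx' : z ≠ σ x) {F : Finset V} (hz : z ∉ F)
    {J : ℕ} (hJ : 1 ≤ J) (hF : #F ≤ J) :
    #(walks G σ m x z) ≤ #{f ∈ walks G σ m x z | IsClean H F σ f} +
      4 * (m + 1) ^ 2 * J * d ^ (m - 2) := by
  set T := walks G σ m x z with hT
  have hcover : T ⊆ {f ∈ T | IsClean H F σ f} ∪
      ((univ.biUnion fun p : Fin (m + 1) × Fin (m + 1) =>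
        {f ∈ T | p.1 < p.2 ∧ f p.1 = f p.2} ∪ {f ∈ T | p.1 < p.2 ∧ f p.1 = σ (f p.2)}) ∪
      ((univ.biUnion fun i : Fin m => {f ∈ T | H.Adj (f i.castSucc) (σ (f i.succ))}) ∪
      (univ.biUnion fun i : Fin (m + 1) => {f ∈ T | i ≠ 0 ∧ f i ∈ F}))) := by
    intro f hf
    by_contra hcon
    simp only [mem_union, mem_biUnion, mem_filter, mem_univ, true_and, hf, not_or,
      not_exists, not_and, Prod.forall] at hcon
    obtain ⟨h1, h2, h3, h4⟩ := hcon
    refine h1 ⟨⟨?_, ?_⟩, h3, h4⟩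
    · intro i j hij
      rcases lt_trichotomy i j with h | h | h
      · exact absurd hij ((h2 i j).1 h)
      · exact h
      · exact absurd hij.symm ((h2 j i).1 h)
    · intro i j hij
      rcases lt_trichotomy i j with h | h | h
      · exact (h2 i j).2 h hij
      · subst h
        exact hσ' _ hij.symm
      · exact (h2 j i).2 h (by rw [hij, hσ])
  have hD : ∀ c, c ≤ 1 * d ^ (m - 2) → c ≤ J * d ^ (m - 2) := fun c hc =>
    hc.trans (Nat.mul_le_mul_right _ hJ)
  have b1 : #(univ.biUnion fun p : Fin (m + 1) × Fin (m + 1) =>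
        {f ∈ T | p.1 < p.2 ∧ f p.1 = f p.2} ∪ {f ∈ T | p.1 < p.2 ∧ f p.1 = σ (f p.2)}) ≤
        ((m + 1) * (m + 1)) * (J * d ^ (m - 2) + J * d ^ (m - 2)) := by
    refine (Finset.card_biUnion_le_card_mul _ _ (J * d ^ (m - 2) + J * d ^ (m - 2)) ?_).trans
      (le_of_eq ?_)
    · rintro ⟨i, j⟩ -
      refine (Finset.card_union_le _ _).trans (Nat.add_le_add ?_ ?_)
      · by_cases h : i < j
        · simp only [h, true_and]
          exact hD _ (card_walks_filter_eq_le hd 1 hzx.symm h)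
        · simp [h]
      · by_cases h : i < j
        · simp only [h, true_and]
          refine hD _ (card_walks_filter_eq_le hd σ ?_ h)
          rintro rfl
          exact hzx' (hσ z).symm
        · simp [h]
    · simp
  have b2 : #(univ.biUnion fun i : Fin m => {f ∈ T | H.Adj (f i.castSucc) (σ (f i.succ))}) ≤
      m * (J * d ^ (m - 2)) := by
    refine (Finset.card_biUnion_le_card_mul _ _ (J * d ^ (m - 2)) ?_).trans
      (le_of_eq ?_)
    · intro i _
      exact hD _ (card_walks_filter_adj_le hd hH hm x z i)
    · simp
  have b3 : #(univ.biUnion fun i : Fin (m + 1) => {f ∈ T | i ≠ 0 ∧ f i ∈ F}) ≤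
      (m + 1) * (J * d ^ (m - 2)) := by
    refine (Finset.card_biUnion_le_card_mul _ _ (J * d ^ (m - 2)) ?_).trans
      (le_of_eq ?_)
    · intro i _
      by_cases h : i = 0
      · simp [h]
      · simp only [ne_eq, h, not_false_eq_true, true_and]
        exact (card_walks_filter_mem_le hd x hz h).trans (Nat.mul_le_mul_right _ hF)
    · simp
  have := (Finset.card_le_card hcover).trans ((Finset.card_union_le _ _).trans
    (Nat.add_le_add_left ((Finset.card_union_le _ _).trans (Nat.add_le_add b1
      ((Finset.card_union_le _ _).trans (Nat.add_le_add b2 b3)))) _))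
  refine this.trans (Nat.add_le_add_left ?_ _)
  nlinarith [Nat.zero_le (J * d ^ (m - 2)), Nat.zero_le (m * m * (J * d ^ (m - 2))),
    Nat.zero_le (m * (J * d ^ (m - 2)))]

end Clean

section Switch

open scoped Classical

variable {V : Type*}

/-- The permutation of `V` sending `v i` to `v (i + 1)` and fixing everything outside the range
of `v`. -/
noncomputable def cyclePerm {m : ℕ} (v : Fin (m + 1) → V) : Equiv.Perm V :=
  if hv : Function.Injective v then (finRotate (m + 1)).viaFintypeEmbedding ⟨v, hv⟩ else 1

theorem cyclePerm_apply {m : ℕ} {v : Fin (m + 1) → V} (hv : Function.Injective v)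
    (i : Fin (m + 1)) : cyclePerm v (v i) = v (i + 1) := by
  have := Equiv.Perm.viaFintypeEmbedding_apply_image (finRotate (m + 1)) ⟨v, hv⟩ i
  simpa [cyclePerm, hv, finRotate_apply] using this

theorem cyclePerm_apply_of_forall_ne {m : ℕ} {v : Fin (m + 1) → V} {w : V} (hw : ∀ i, w ≠ v i) :
    cyclePerm v w = w := by
  unfold cyclePerm
  split_ifs with hv
  · refine Equiv.Perm.viaFintypeEmbedding_apply_notMem_range _ _ ?_
    rintro ⟨i, rfl⟩
    exact hw i rfl
  · rfl

/-- Exchanges the pairs `{v i, σ (v i)}` of the involution `σ` for the pairs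
`{v i, σ (v (i + 1))}`. -/
noncomputable def switch {m : ℕ} (v : Fin (m + 1) → V) (σ : Equiv.Perm V) : Equiv.Perm V :=
  (cyclePerm v)⁻¹ * σ * cyclePerm v

variable {m : ℕ} {v : Fin (m + 1) → V} {σ : Equiv.Perm V}

theorem switch_switch_apply (hσ : ∀ w, σ (σ w) = w) (w : V) :
    switch v σ (switch v σ w) = w := by
  simp [switch, hσ]

theorem switch_apply (hv : Function.Injective v) (hd : ∀ i j, v i ≠ σ (v j)) (i : Fin (m + 1)) :
    switch v σ (v i) = σ (v (i + 1)) := by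
  simp only [switch, Equiv.Perm.mul_apply, cyclePerm_apply hv, Equiv.Perm.inv_eq_iff_eq]
  rw [cyclePerm_apply_of_forall_ne]
  exact fun j => (hd j _).symm

theorem switch_apply_image (hv : Function.Injective v) (hd : ∀ i j, v i ≠ σ (v j))
    (hσ : ∀ w, σ (σ w) = w) (i : Fin (m + 1)) :
    switch v σ (σ (v (i + 1))) = v i := by
  rw [← switch_apply hv hd, switch_switch_apply hσ]

theorem switch_apply_of_forall_ne (hσ : ∀ w, σ (σ w) = w) {w : V}
    (h1 : ∀ i, w ≠ v i) (h2 : ∀ i, w ≠ σ (v i)) : switch v σ w = σ w := by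
  simp only [switch, Equiv.Perm.mul_apply, cyclePerm_apply_of_forall_ne h1,
    Equiv.Perm.inv_eq_iff_eq]
  rw [cyclePerm_apply_of_forall_ne]
  intro i hi
  exact h2 i (by rw [← hi, hσ])

theorem eq_or_eq_or_switch_eq (hσ : ∀ w, σ (σ w) = w) (v : Fin (m + 1) → V) (w : V) :
    (∃ i, w = v i) ∨ (∃ i, w = σ (v (i + 1))) ∨
      ((∀ i, w ≠ v i) ∧ (∀ i, w ≠ σ (v i)) ∧ switch v σ w = σ w) := by
  by_cases h1 : ∃ i, w = v i
  · exact Or.inl h1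
  by_cases h2 : ∃ i, w = σ (v i)
  · obtain ⟨i, hi⟩ := h2
    exact Or.inr (Or.inl ⟨i - 1, by rw [sub_add_cancel, hi]⟩)
  push Not at h1 h2
  exact Or.inr (Or.inr ⟨h1, h2, switch_apply_of_forall_ne hσ h1 h2⟩)

theorem switch_injective_right (v : Fin (m + 1) → V) : Function.Injective (switch v) := by
  intro σ τ h
  simpa [switch] using h

theorem adj_switch {G : SimpleGraph V} (hσ : ∀ w, σ (σ w) = w) (hσG : ∀ w, G.Adj w (σ w))
    (hv : Function.Injective v) (hd : ∀ i j, v i ≠ σ (v j))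
    (hG : ∀ i, G.Adj (v i) (σ (v (i + 1)))) (w : V) : G.Adj w (switch v σ w) := by
  rcases eq_or_eq_or_switch_eq hσ v w with ⟨i, rfl⟩ | ⟨i, rfl⟩ | ⟨-, -, h⟩
  · rw [switch_apply hv hd]
    exact hG i
  · rw [switch_apply_image hv hd hσ]
    exact (hG i).symm
  · rw [h]
    exact hσG w

theorem forall_fin_cyclic {P : Fin (m + 1) → Fin (m + 1) → Prop}
    (h1 : ∀ i : Fin m, P i.castSucc i.succ) (h2 : P (Fin.last m) 0) (i : Fin (m + 1)) :
    P i (i + 1) := by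
  refine Fin.lastCases ?_ (fun j => ?_) i
  · rwa [Fin.last_add_one]
  · rw [Fin.coeSucc_eq_succ]
    exact h1 j

variable [Fintype V]

/-- The vertices whose pair under `σ` is an edge of `H`. -/
noncomputable def onEdges (H : SimpleGraph V) (σ : Equiv.Perm V) : Finset V :=
  {w | H.Adj w (σ w)}

@[simp] theorem mem_onEdges {H : SimpleGraph V} {σ : Equiv.Perm V} {w : V} :
    w ∈ onEdges H σ ↔ H.Adj w (σ w) := by simp [onEdges]

/-- Perfect matchings of `G` with exactly `k` edges in `H`, as fixed-point-free involutions. -/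
noncomputable def matchPerms (G H : SimpleGraph V) (k : ℕ) : Finset (Equiv.Perm V) :=
  {σ | (∀ w, σ (σ w) = w) ∧ (∀ w, G.Adj w (σ w)) ∧ #(onEdges H σ) = 2 * k}

/-- Clean `G`-walks for `σ` along which switching removes an edge of `H`. -/
noncomputable def downWalks (G H : SimpleGraph V) (m : ℕ) (σ : Equiv.Perm V) :
    Finset (Fin (m + 1) → V) :=
  {f | (∀ i : Fin m, G.Adj (f i.castSucc) (σ (f i.succ))) ∧ IsClean H (onEdges H σ) σ f ∧
    H.Adj (f 0) (σ (f 0)) ∧ G.Adj (f (Fin.last m)) (σ (f 0)) ∧ ¬ H.Adj (f (Fin.last m)) (σ (f 0))}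

/-- Clean `G`-walks for `σ` along which switching adds an edge of `H`. -/
noncomputable def upWalks (G H : SimpleGraph V) (m : ℕ) (σ : Equiv.Perm V) :
    Finset (Fin (m + 1) → V) :=
  {f | (∀ i : Fin m, G.Adj (f i.castSucc) (σ (f i.succ))) ∧ IsClean H (onEdges H σ) σ f ∧
    ¬ H.Adj (f 0) (σ (f 0)) ∧ H.Adj (f (Fin.last m)) (σ (f 0))}

theorem onEdges_switch_of_mem_downWalks {G H : SimpleGraph V} (hσ : ∀ w, σ (σ w) = w)
    (hv : v ∈ downWalks G H m σ) :
    onEdges H (switch v σ) = onEdges H σ \ {v 0, σ (v 0)} := by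
  simp only [downWalks, IsClean, mem_filter, mem_univ, true_and, mem_onEdges] at hv
  obtain ⟨h1, ⟨⟨hinj, hd⟩, h2, h3⟩, h4, h5, h6⟩ := hv
  have hH : ∀ i, ¬ H.Adj (v i) (σ (v (i + 1))) :=
    forall_fin_cyclic (P := fun i j => ¬ H.Adj (v i) (σ (v j))) h2 h6
  ext w
  simp only [mem_onEdges, mem_sdiff, mem_insert, mem_singleton, not_or]
  rcases eq_or_eq_or_switch_eq hσ v w with ⟨i, rfl⟩ | ⟨i, rfl⟩ | ⟨h7, h8, h9⟩
  · rw [switch_apply hinj hd]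
    refine iff_of_false (hH i) ?_
    rintro ⟨h, h', -⟩
    exact h3 i (fun hi => h' (by rw [hi])) h
  · rw [switch_apply_image hinj hd hσ]
    refine iff_of_false (fun h => hH i h.symm) ?_
    rintro ⟨h, -, h'⟩
    rw [hσ] at h
    exact h3 (i + 1) (fun hi => h' (by rw [hi])) h.symm
  · rw [h9]
    exact ⟨fun h => ⟨h, h7 0, h8 0⟩, fun h => h.1⟩

theorem onEdges_switch_of_mem_upWalks {G H : SimpleGraph V} (hσ : ∀ w, σ (σ w) = w)
    (hv : v ∈ upWalks G H m σ) :
    onEdges H (switch v σ) = onEdges H σ ∪ {v (Fin.last m), σ (v 0)} := by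
  simp only [upWalks, IsClean, mem_filter, mem_univ, true_and, mem_onEdges] at hv
  obtain ⟨h1, ⟨⟨hinj, hd⟩, h2, h3⟩, h4, h5⟩ := hv
  have h3' : ∀ i, ¬ H.Adj (v i) (σ (v i)) := by
    intro i
    by_cases hi : i = 0
    · rwa [hi]
    · exact h3 i hi
  have hH : ∀ i, i ≠ Fin.last m → ¬ H.Adj (v i) (σ (v (i + 1))) := by
    intro i
    refine Fin.lastCases (fun h => absurd rfl h) (fun j _ => ?_) i
    rw [Fin.coeSucc_eq_succ]
    exact h2 j
  ext w
  simp only [mem_onEdges, mem_union, mem_insert, mem_singleton]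
  rcases eq_or_eq_or_switch_eq hσ v w with ⟨i, rfl⟩ | ⟨i, rfl⟩ | ⟨h7, h8, h9⟩
  · rw [switch_apply hinj hd]
    constructor
    · intro h
      by_contra hcon
      push Not at hcon
      exact hH i (fun hi => hcon.2.1 (by rw [hi])) h
    · rintro (h | h | h)
      · exact absurd h (h3' i)
      · rw [hinj h, Fin.last_add_one]
        exact h5
      · exact absurd h (hd _ _)
  · rw [switch_apply_image hinj hd hσ, hσ]
    constructor
    · intro h
      by_contra hcon
      push Not at hcon
      refine hH i (fun hi => hcon.2.2 (by rw [hi, Fin.last_add_one])) h.symm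
    · rintro (h | h | h)
      · exact absurd h.symm (h3' _)
      · exact absurd h.symm (hd _ _)
      · have hi : i + 1 = 0 := hinj (σ.injective h)
        have hi' : i = Fin.last m := by
          rw [← Fin.last_add_one] at hi
          exact add_right_cancel hi
        rw [hi', Fin.last_add_one]
        exact h5.symm
  · rw [h9]
    refine ⟨fun h => Or.inl h, ?_⟩
    rintro (h | h | h)
    · exact h
    · exact absurd h (h7 _)
    · exact absurd h (h8 _)

theorem switch_mem_of_mem_downWalks {G H : SimpleGraph V} {k : ℕ}
    (hσ : σ ∈ matchPerms G H (k + 1)) (hv : v ∈ downWalks G H m σ) :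
    switch v σ ∈ matchPerms G H k ∧
      (fun i => σ (v (i + 1))) ∈ upWalks G H m (switch v σ) := by
  simp only [matchPerms, mem_filter, mem_univ, true_and] at hσ
  obtain ⟨hinv, hσG, hcard⟩ := hσ
  have hon := onEdges_switch_of_mem_downWalks hinv hv
  simp only [downWalks, IsClean, mem_filter, mem_univ, true_and, mem_onEdges] at hv
  obtain ⟨h1, ⟨⟨hinj, hd⟩, h2, h3⟩, h4, h5, h6⟩ := hv
  have hG : ∀ i, G.Adj (v i) (σ (v (i + 1))) :=
    forall_fin_cyclic (P := fun i j => G.Adj (v i) (σ (v j))) h1 h5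
  have hH : ∀ i, ¬ H.Adj (v i) (σ (v (i + 1))) :=
    forall_fin_cyclic (P := fun i j => ¬ H.Adj (v i) (σ (v j))) h2 h6
  constructor
  · simp only [matchPerms, mem_filter, mem_univ, true_and]
    refine ⟨switch_switch_apply hinv, adj_switch hinv hσG hinj hd hG, ?_⟩
    rw [hon, Finset.card_sdiff_of_subset, hcard, Finset.card_pair (hd 0 0)]
    · omega
    · intro w hw
      simp only [mem_insert, mem_singleton] at hw
      rcases hw with rfl | rfl
      · simpa using h4
      · simpa [hinv] using h4.symm
  · simp only [upWalks, IsClean, mem_filter, mem_univ, true_and, mem_onEdges,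
      switch_apply_image hinj hd hinv, Fin.coeSucc_eq_succ, Fin.last_add_one]
    refine ⟨fun i => (hσG _).symm, ⟨⟨?_, ?_⟩, ?_, ?_⟩, ?_, h4.symm⟩
    · intro i j hij
      exact add_right_cancel (hinj (σ.injective hij))
    · exact fun i j => (hd j _).symm
    · exact fun i h => h3 _ (Fin.succ_ne_zero i) h.symm
    · exact fun i _ h => hH i h.symm
    · exact fun h => hH 0 h.symm

theorem switch_mem_of_mem_upWalks {G H : SimpleGraph V} (hHG : H ≤ G) {k : ℕ}
    (hσ : σ ∈ matchPerms G H k) (hv : v ∈ upWalks G H m σ) :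
    switch v σ ∈ matchPerms G H (k + 1) ∧
      (fun i => σ (v i)) ∈ downWalks G H m (switch v σ) := by
  simp only [matchPerms, mem_filter, mem_univ, true_and] at hσ
  obtain ⟨hinv, hσG, hcard⟩ := hσ
  have hon := onEdges_switch_of_mem_upWalks hinv hv
  simp only [upWalks, IsClean, mem_filter, mem_univ, true_and, mem_onEdges] at hv
  obtain ⟨h1, ⟨⟨hinj, hd⟩, h2, h3⟩, h4, h5⟩ := hv
  have h3' : ∀ i, ¬ H.Adj (v i) (σ (v i)) := by
    intro i
    by_cases hi : i = 0
    · rwa [hi]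
    · exact h3 i hi
  have hG : ∀ i, G.Adj (v i) (σ (v (i + 1))) :=
    forall_fin_cyclic (P := fun i j => G.Adj (v i) (σ (v j))) h1 (hHG h5)
  have himg : ∀ i : Fin m, switch v σ (σ (v i.succ)) = v i.castSucc := by
    intro i
    rw [← Fin.coeSucc_eq_succ, switch_apply_image hinj hd hinv]
  have himg0 : switch v σ (σ (v 0)) = v (Fin.last m) := by
    rw [← Fin.last_add_one, switch_apply_image hinj hd hinv]
  constructor
  · simp only [matchPerms, mem_filter, mem_univ, true_and]
    refine ⟨switch_switch_apply hinv, adj_switch hinv hσG hinj hd hG, ?_⟩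
    rw [hon, Finset.card_union_of_disjoint, hcard, Finset.card_pair (hd _ _)]
    · ring
    · rw [Finset.disjoint_left]
      intro w hw hw'
      simp only [mem_insert, mem_singleton, mem_onEdges] at hw hw'
      rcases hw' with rfl | rfl
      · exact h3' _ hw
      · rw [hinv] at hw
        exact h3' _ hw.symm
  · simp only [downWalks, IsClean, mem_filter, mem_univ, true_and, mem_onEdges, himg, himg0]
    refine ⟨fun i => (hσG _).symm, ⟨⟨?_, ?_⟩, ?_, ?_⟩, h5.symm, (hσG _).symm, ?_⟩
    · exact σ.injective.comp hinj
    · intro i j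
      rw [← sub_add_cancel j 1, switch_apply_image hinj hd hinv]
      exact (hd _ _).symm
    · exact fun i h => h3' _ h.symm
    · intro i
      refine Fin.cases (fun h => absurd rfl h) (fun j _ => ?_) i
      rw [himg]
      exact fun h => h2 j h.symm
    · exact fun h => h3' _ h.symm

theorem sum_card_downWalks_eq {G H : SimpleGraph V} (hHG : H ≤ G) (m k : ℕ) :
    ∑ σ ∈ matchPerms G H (k + 1), #(downWalks G H m σ) =
      ∑ σ ∈ matchPerms G H k, #(upWalks G H m σ) := by
  rw [← Finset.card_sigma, ← Finset.card_sigma]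
  have hclean : ∀ {σ : Equiv.Perm V} {v : Fin (m + 1) → V},
      v ∈ downWalks G H m σ ∨ v ∈ upWalks G H m σ →
        Function.Injective v ∧ ∀ i j, v i ≠ σ (v j) := by
    rintro σ v (h | h)
    · simp only [downWalks, mem_filter, mem_univ, true_and] at h
      exact h.2.1.1
    · simp only [upWalks, mem_filter, mem_univ, true_and] at h
      exact h.2.1.1
  apply le_antisymm
  · refine Finset.card_le_card_of_injOn (fun p => ⟨switch p.2 p.1, fun i => p.1 (p.2 (i + 1))⟩)
      ?_ ?_
    · rintro ⟨σ, v⟩ h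
      simp only [coe_sigma, Set.mem_sigma_iff, mem_coe] at h ⊢
      exact switch_mem_of_mem_downWalks h.1 h.2
    · rintro ⟨σ, v⟩ h ⟨σ', v'⟩ h' heq
      simp only [coe_sigma, Set.mem_sigma_iff, mem_coe] at h h'
      simp only [Sigma.mk.injEq, heq_eq_eq] at heq
      obtain ⟨e1, e2⟩ := heq
      have hσ : ∀ w, σ (σ w) = w := by
        have := h.1
        simp only [matchPerms, mem_filter] at this
        exact this.2.1
      have hσ' : ∀ w, σ' (σ' w) = w := by
        have := h'.1
        simp only [matchPerms, mem_filter] at this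
        exact this.2.1
      obtain ⟨hi, hd⟩ := hclean (Or.inl h.2)
      obtain ⟨hi', hd'⟩ := hclean (Or.inl h'.2)
      have hvv : v = v' := by
        funext i
        rw [← switch_apply_image hi hd hσ i, ← switch_apply_image hi' hd' hσ' i, e1]
        exact congrArg _ (congrFun e2 i)
      subst hvv
      rw [switch_injective_right v e1]
  · refine Finset.card_le_card_of_injOn (fun p => ⟨switch p.2 p.1, fun i => p.1 (p.2 i)⟩)
      ?_ ?_
    · rintro ⟨σ, v⟩ h
      simp only [coe_sigma, Set.mem_sigma_iff, mem_coe] at h ⊢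
      exact switch_mem_of_mem_upWalks hHG h.1 h.2
    · rintro ⟨σ, v⟩ h ⟨σ', v'⟩ h' heq
      simp only [coe_sigma, Set.mem_sigma_iff, mem_coe] at h h'
      simp only [Sigma.mk.injEq, heq_eq_eq] at heq
      obtain ⟨e1, e2⟩ := heq
      have hσ : ∀ w, σ (σ w) = w := by
        have := h.1
        simp only [matchPerms, mem_filter] at this
        exact this.2.1
      have hσ' : ∀ w, σ' (σ' w) = w := by
        have := h'.1
        simp only [matchPerms, mem_filter] at this
        exact this.2.1
      obtain ⟨hi, hd⟩ := hclean (Or.inr h.2)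
      obtain ⟨hi', hd'⟩ := hclean (Or.inr h'.2)
      have hvv : v = v' := by
        funext i
        rw [← switch_apply_image hi hd hσ i, ← switch_apply_image hi' hd' hσ' i, e1]
        exact congrArg _ (congrFun e2 (i + 1))
      subst hvv
      rw [switch_injective_right v e1]

end Switch

section Degrees

open scoped Classical

variable {V : Type*} [Fintype V]

/-- For every fixed-point-free involution, the number of walks of length `m` between two vertices
is at most `(1 + ξ) * D`, and the number of clean ones avoiding a set of size at most `J` is at
least `(1 - ξ) * D`. -/
def CleanWalkEstimate (G H : SimpleGraph V) (m J : ℕ) (D ξ : ℝ) : Prop :=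
  ∀ σ : Equiv.Perm V, (∀ w, σ (σ w) = w) → (∀ w, σ w ≠ w) → ∀ F : Finset V, #F ≤ J →
    ∀ x z, (#(walks G σ m x z) : ℝ) ≤ (1 + ξ) * D ∧
      (z ≠ x → z ≠ σ x → z ∉ F → (1 - ξ) * D ≤ #{f ∈ walks G σ m x z | IsClean H F σ f})

theorem cleanWalkEstimate_of_mixing {G H : SimpleGraph V} {d : ℕ} (hd0 : 0 < d)
    (hd : ∀ x, #{y | G.Adj x y} = d) (hH : ∀ a b c, H.Adj a b → H.Adj a c → b = c)
    {m J : ℕ} (hm : 2 ≤ m) (hJ : 1 ≤ J) {ε ξ : ℝ}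
    (hmix : ∀ (σ : Equiv.Perm V) (x z : V),
      |(#(walks G σ m x z) : ℝ) - d ^ m / Fintype.card V| ≤ ε * d ^ m)
    (hξ : ε * Fintype.card V + 4 * (m + 1) ^ 2 * J * (Fintype.card V / d ^ 2) ≤ ξ) :
    CleanWalkEstimate G H m J (d ^ m / Fintype.card V) ξ := by
  intro σ hσ hσ' F hF x z
  have hn : (0 : ℝ) < Fintype.card V := by exact_mod_cast Fintype.card_pos_iff.2 ⟨x⟩
  set n : ℝ := (Fintype.card V : ℝ)
  have hd0' : (0 : ℝ) < d := by exact_mod_cast hd0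
  obtain ⟨h1, h2⟩ := abs_le.1 (hmix σ x z)
  set D : ℝ := d ^ m / n with hD
  have hD0 : 0 < D := by positivity
  have hDn : ε * d ^ m = ε * n * D := by rw [hD]; field_simp
  have hbad : (4 * (m + 1) ^ 2 * J * d ^ (m - 2) : ℝ) =
      4 * (m + 1) ^ 2 * J * (n / d ^ 2) * D := by
    rw [hD]
    obtain ⟨l, rfl⟩ : ∃ l, m = l + 2 := ⟨m - 2, by omega⟩
    rw [Nat.add_sub_cancel, pow_add]
    field_simp
  have hbad0 : 0 ≤ 4 * (m + 1) ^ 2 * J * (n / d ^ 2) * D := by positivity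
  have hξD := mul_le_mul_of_nonneg_right hξ hD0.le
  constructor
  · linarith
  · intro hzx hzx' hz
    have h3 := card_walks_le_card_clean_add hd hH hσ hσ' hm hzx hzx' hz hJ hF
    have h4 : (#(walks G σ m x z) : ℝ) ≤ #{f ∈ walks G σ m x z | IsClean H F σ f} +
      4 * (m + 1) ^ 2 * J * d ^ (m - 2) := by exact_mod_cast h3
    linarith

theorem card_clean_eq_sum (G H : SimpleGraph V) (m : ℕ) (σ : Equiv.Perm V) (F : Finset V)
    (P : V → V → Prop) [DecidableRel P] :
    #{f : Fin (m + 1) → V | (∀ i : Fin m, G.Adj (f i.castSucc) (σ (f i.succ))) ∧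
        IsClean H F σ f ∧ P (f 0) (f (Fin.last m))} =
      ∑ p : V × V with P p.1 p.2, #{f ∈ walks G σ m p.1 p.2 | IsClean H F σ f} := by
  rw [Finset.card_eq_sum_card_fiberwise (f := fun f => (f 0, f (Fin.last m)))
    (t := ({p : V × V | P p.1 p.2} : Finset (V × V)))]
  · refine Finset.sum_congr rfl ?_
    rintro ⟨x, z⟩ hp
    simp only [mem_filter, mem_univ, true_and] at hp
    congr 1
    ext f
    simp only [walks, mem_filter, mem_univ, true_and, Prod.mk.injEq]
    constructor
    · rintro ⟨⟨h1, h2, -⟩, rfl, rfl⟩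
      exact ⟨⟨rfl, rfl, h1⟩, h2⟩
    · rintro ⟨⟨rfl, rfl, h1⟩, h2⟩
      exact ⟨⟨h1, h2, hp⟩, rfl, rfl⟩
  · intro f hf
    simp only [coe_filter, mem_univ, true_and, Set.mem_ofPred_eq] at hf ⊢
    exact hf.2.2

theorem card_filter_prod (P : V → V → Prop) [DecidableRel P] :
    #{p : V × V | P p.1 p.2} = ∑ x, #{z | P x z} := by
  simp only [Finset.card_filter]
  exact Fintype.sum_prod_type _

theorem card_clean_le {G H : SimpleGraph V} {m J : ℕ} {D ξ : ℝ}
    (h : CleanWalkEstimate G H m J D ξ) {σ : Equiv.Perm V} (hσ : ∀ w, σ (σ w) = w)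
    (hσ' : ∀ w, σ w ≠ w) {F : Finset V} (hF : #F ≤ J) (s : Finset (V × V)) :
    ((∑ p ∈ s, #{f ∈ walks G σ m p.1 p.2 | IsClean H F σ f} : ℕ) : ℝ) ≤ #s * ((1 + ξ) * D) := by
  push_cast
  rw [← nsmul_eq_mul]
  refine Finset.sum_le_card_nsmul _ _ _ fun p _ => ?_
  refine le_trans ?_ (h σ hσ hσ' F hF p.1 p.2).1
  exact_mod_cast Finset.card_le_card (Finset.filter_subset _ _)

theorem le_card_clean {G H : SimpleGraph V} {m J : ℕ} {D ξ : ℝ}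
    (h : CleanWalkEstimate G H m J D ξ) {σ : Equiv.Perm V} (hσ : ∀ w, σ (σ w) = w)
    (hσ' : ∀ w, σ w ≠ w) {F : Finset V} (hF : #F ≤ J) {s : Finset (V × V)}
    (hs : ∀ p ∈ s, p.2 ≠ p.1 ∧ p.2 ≠ σ p.1 ∧ p.2 ∉ F) :
    #s * ((1 - ξ) * D) ≤
      ((∑ p ∈ s, #{f ∈ walks G σ m p.1 p.2 | IsClean H F σ f} : ℕ) : ℝ) := by
  push_cast
  rw [← nsmul_eq_mul]
  refine Finset.card_nsmul_le_sum _ _ _ fun p hp => ?_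
  obtain ⟨h1, h2, h3⟩ := hs p hp
  exact (h σ hσ hσ' F hF p.1 p.2).2 h1 h2 h3

theorem card_upPairs_add {H : SimpleGraph V} (hH : ∀ a b c, H.Adj a b → H.Adj a c → b = c)
    (σ : Equiv.Perm V) {k s : ℕ} (hk : #(onEdges H σ) = 2 * k)
    (hs : #{p : V × V | H.Adj p.1 p.2} = 2 * s) :
    #{p : V × V | ¬ H.Adj p.1 (σ p.1) ∧ H.Adj p.2 (σ p.1)} + 2 * k = 2 * s := by
  have h1 : #{p : V × V | H.Adj p.2 (σ p.1)} = 2 * s := by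
    rw [← hs]
    refine Finset.card_bij' (fun p _ => (σ p.1, p.2)) (fun p _ => (σ.symm p.1, p.2)) ?_ ?_ ?_ ?_ <;>
      simp [H.adj_comm]
  have h2 : #{p : V × V | H.Adj p.1 (σ p.1) ∧ H.Adj p.2 (σ p.1)} = 2 * k := by
    rw [← hk]
    refine Finset.card_bij' (fun p _ => p.1) (fun x _ => (x, x)) ?_ ?_ ?_ ?_
    · rintro ⟨x, z⟩ h
      simp only [mem_filter, mem_univ, true_and] at h
      simpa using h.1
    · intro x hx
      simpa using hx
    · rintro ⟨x, z⟩ h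
      simp only [mem_filter, mem_univ, true_and] at h
      rw [hH _ _ _ h.1.symm h.2.symm]
    · intro x _
      rfl
  rw [← h1, ← h2, ← Finset.card_union_of_disjoint]
  · congr 1
    ext p
    simp only [mem_union, mem_filter, mem_univ, true_and]
    tauto
  · rw [Finset.disjoint_left]
    intro p hp hp'
    simp only [mem_filter, mem_univ, true_and] at hp hp'
    exact hp.1 hp'.1

theorem card_downPairs_le {G H : SimpleGraph V} {d : ℕ} (hd : ∀ x, #{y | G.Adj x y} = d)
    {σ : Equiv.Perm V} {k : ℕ} (hk : #(onEdges H σ) = 2 * k) :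
    #{p : V × V | H.Adj p.1 (σ p.1) ∧ G.Adj p.2 (σ p.1) ∧ ¬ H.Adj p.2 (σ p.1)} ≤ 2 * k * d := by
  rw [card_filter_prod fun x z => H.Adj x (σ x) ∧ G.Adj z (σ x) ∧ ¬ H.Adj z (σ x)]
  rw [← hk, ← Finset.sum_subset (Finset.subset_univ (onEdges H σ)), ← smul_eq_mul]
  · refine Finset.sum_le_card_nsmul _ _ _ fun x _ => ?_
    rw [← hd (σ x)]
    refine Finset.card_le_card fun z hz => ?_
    simp only [mem_filter, mem_univ, true_and] at hz ⊢
    exact hz.2.1.symm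
  · intro x _ hx
    rw [mem_onEdges] at hx
    simp [hx]

theorem le_card_downPairs {G H : SimpleGraph V} {d : ℕ} (hd : ∀ x, #{y | G.Adj x y} = d)
    {σ : Equiv.Perm V} {k : ℕ} (hk : #(onEdges H σ) = 2 * k) :
    2 * k * (d - 2 * k) ≤
      #{p : V × V | H.Adj p.1 (σ p.1) ∧ G.Adj p.2 (σ p.1) ∧ p.2 ∉ onEdges H σ} := by
  rw [card_filter_prod fun x z => H.Adj x (σ x) ∧ G.Adj z (σ x) ∧ z ∉ onEdges H σ]
  rw [← Finset.sum_subset (Finset.subset_univ (onEdges H σ))]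
  · rw [← hk, ← smul_eq_mul]
    refine Finset.card_nsmul_le_sum _ _ _ fun x hx => ?_
    rw [← hd (σ x)]
    refine (Finset.le_card_sdiff _ _).trans (Finset.card_le_card fun z hz => ?_)
    rw [mem_onEdges] at hx
    simp only [mem_sdiff, mem_filter, mem_univ, true_and] at hz ⊢
    exact ⟨hx, hz.1.symm, hz.2⟩
  · intro x _ hx
    rw [mem_onEdges] at hx
    simp [hx]

theorem matchPerms_ratio_bounds {G H : SimpleGraph V} (hHG : H ≤ G) {d : ℕ}
    (hd : ∀ x, #{y | G.Adj x y} = d) (hH : ∀ a b c, H.Adj a b → H.Adj a c → b = c)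
    {s : ℕ} (hs : #{p : V × V | H.Adj p.1 p.2} = 2 * s) {m J k : ℕ} {D ξ : ℝ} (hD : 0 < D)
    (hξ : 0 ≤ ξ) (hξ1 : ξ ≤ 1)
    (hest : CleanWalkEstimate G H m J D ξ) (hkJ : 2 * (k + 1) ≤ J) :
    (#(matchPerms G H k) : ℝ) * ((s - k) * (1 - ξ)) ≤
        #(matchPerms G H (k + 1)) * ((k + 1) * d * (1 + ξ)) ∧
      (#(matchPerms G H (k + 1)) : ℝ) * ((k + 1) * (d - 2 * (k + 1)) * (1 - ξ)) ≤
        #(matchPerms G H k) * ((s - k) * (1 + ξ)) := by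
  have hup : ∀ σ ∈ matchPerms G H k,
      2 * ((s : ℝ) - k) * ((1 - ξ) * D) ≤ #(upWalks G H m σ) ∧
        (#(upWalks G H m σ) : ℝ) ≤ 2 * ((s : ℝ) - k) * ((1 + ξ) * D) := by
    intro σ hσ
    simp only [matchPerms, mem_filter, mem_univ, true_and] at hσ
    obtain ⟨h1, h2, h3⟩ := hσ
    have h2' : ∀ w, σ w ≠ w := fun w => (h2 w).ne'
    have hF : #(onEdges H σ) ≤ J := by omega
    have hc := card_upPairs_add hH σ h3 hs
    have hc' : (#{p : V × V | ¬ H.Adj p.1 (σ p.1) ∧ H.Adj p.2 (σ p.1)} : ℝ) =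
        2 * ((s : ℝ) - k) := by
      have : (#{p : V × V | ¬ H.Adj p.1 (σ p.1) ∧ H.Adj p.2 (σ p.1)} : ℝ) + 2 * k = 2 * s := by
        exact_mod_cast hc
      linarith
    rw [upWalks, card_clean_eq_sum G H m σ _ fun x z => ¬ H.Adj x (σ x) ∧ H.Adj z (σ x), ← hc']
    refine ⟨le_card_clean hest h1 h2' hF ?_, card_clean_le hest h1 h2' hF _⟩
    rintro ⟨x, z⟩ hp
    simp only [mem_filter, mem_univ, true_and] at hp
    obtain ⟨hp1, hp2⟩ := hp
    have hzx : z ≠ x := by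
      rintro rfl
      exact hp1 hp2
    refine ⟨hzx, hp2.ne, ?_⟩
    rw [mem_onEdges]
    intro hz
    exact hzx (σ.injective (hH _ _ _ hz hp2))
  have hdown : ∀ σ ∈ matchPerms G H (k + 1),
      2 * ((k : ℝ) + 1) * (d - 2 * (k + 1)) * ((1 - ξ) * D) ≤ #(downWalks G H m σ) ∧
        (#(downWalks G H m σ) : ℝ) ≤ 2 * ((k : ℝ) + 1) * d * ((1 + ξ) * D) := by
    intro σ hσ
    simp only [matchPerms, mem_filter, mem_univ, true_and] at hσ
    obtain ⟨h1, h2, h3⟩ := hσ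
    have h2' : ∀ w, σ w ≠ w := fun w => (h2 w).ne'
    have hF : #(onEdges H σ) ≤ J := by omega
    rw [downWalks, card_clean_eq_sum G H m σ _
      fun x z => H.Adj x (σ x) ∧ G.Adj z (σ x) ∧ ¬ H.Adj z (σ x)]
    constructor
    · have hsub : ({p : V × V | H.Adj p.1 (σ p.1) ∧ G.Adj p.2 (σ p.1) ∧ p.2 ∉ onEdges H σ} :
          Finset (V × V)) ⊆
          ({p : V × V | H.Adj p.1 (σ p.1) ∧ G.Adj p.2 (σ p.1) ∧ ¬ H.Adj p.2 (σ p.1)} :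
          Finset (V × V)) := by
        rintro ⟨x, z⟩ hp
        simp only [mem_filter, mem_univ, true_and, mem_onEdges] at hp ⊢
        refine ⟨hp.1, hp.2.1, fun hz => hp.2.2 ?_⟩
        rw [hH _ _ _ hz.symm hp.1.symm]
        exact hp.1
      have hle := Finset.sum_le_sum_of_subset (f := fun p : V × V =>
        #{f ∈ walks G σ m p.1 p.2 | IsClean H (onEdges H σ) σ f}) hsub
      refine le_trans ?_ (Nat.cast_le.2 hle)
      refine le_trans ?_ (le_card_clean hest h1 h2' hF ?_)
      · have h0 : 0 ≤ (1 - ξ) * D := mul_nonneg (by linarith) hD.le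
        refine mul_le_mul_of_nonneg_right ?_ h0
        refine le_trans ?_ (Nat.cast_le.2 (le_card_downPairs (G := G) hd h3))
        push_cast
        refine mul_le_mul_of_nonneg_left ?_ (by positivity)
        have : d ≤ (d - 2 * (k + 1)) + 2 * (k + 1) := by omega
        have : (d : ℝ) ≤ (d - 2 * (k + 1) : ℕ) + 2 * (k + 1) := by exact_mod_cast this
        linarith
      · rintro ⟨x, z⟩ hp
        simp only [mem_filter, mem_univ, true_and, mem_onEdges] at hp
        refine ⟨?_, hp.2.1.ne, ?_⟩
        · show z ≠ x
          rintro rfl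
          exact hp.2.2 hp.1
        · simpa using hp.2.2
    · refine (card_clean_le hest h1 h2' hF _).trans ?_
      have h0 : 0 ≤ (1 + ξ) * D := mul_nonneg (by linarith) hD.le
      refine mul_le_mul_of_nonneg_right ?_ h0
      have := card_downPairs_le (G := G) hd h3
      exact_mod_cast this
  have hsum : (∑ σ ∈ matchPerms G H (k + 1), (#(downWalks G H m σ) : ℝ)) =
      ∑ σ ∈ matchPerms G H k, (#(upWalks G H m σ) : ℝ) := by
    exact_mod_cast sum_card_downWalks_eq hHG m k
  have hu1 := Finset.card_nsmul_le_sum _ _ _ fun σ hσ => (hup σ hσ).1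
  have hu2 := Finset.sum_le_card_nsmul _ _ _ fun σ hσ => (hup σ hσ).2
  have hd1 := Finset.card_nsmul_le_sum _ _ _ fun σ hσ => (hdown σ hσ).1
  have hd2 := Finset.sum_le_card_nsmul _ _ _ fun σ hσ => (hdown σ hσ).2
  rw [nsmul_eq_mul] at hu1 hu2 hd1 hd2
  rw [hsum] at hd1 hd2
  have h2D : 0 < 2 * D := by positivity
  constructor
  · refine le_of_mul_le_mul_right ?_ h2D
    linarith
  · refine le_of_mul_le_mul_right ?_ h2D
    linarith

end Degrees

section Existence

open scoped Classical

variable {V : Type*} [Fintype V]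

theorem exists_perm_involutive_ne (h : Even (Fintype.card V)) :
    ∃ σ : Equiv.Perm V, (∀ w, σ (σ w) = w) ∧ ∀ w, σ w ≠ w := by
  obtain ⟨r, hr⟩ := h
  let e : V ≃ Fin r ⊕ Fin r := (Fintype.equivFinOfCardEq hr).trans finSumFinEquiv.symm
  refine ⟨(e.trans (Equiv.sumComm _ _)).trans e.symm, fun w => by simp, fun w hw => ?_⟩
  have h1 : (e w).swap = e w := by
    simpa [Equiv.symm_apply_eq] using hw
  cases h2 : e w <;> simp [h2] at h1

theorem matchPerms_zero_nonempty {G H : SimpleGraph V} (hV : Even (Fintype.card V)) {d : ℕ}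
    (hd : ∀ x, #{y | G.Adj x y} = d) (hd3 : 3 ≤ d) (hH : ∀ a b c, H.Adj a b → H.Adj a c → b = c)
    {m J : ℕ} {D ξ : ℝ} (hD : 0 < D) (hξ : ξ < 1) (hest : CleanWalkEstimate G H m J D ξ) :
    (matchPerms G H 0).Nonempty := by
  let bad : Equiv.Perm V → Finset V := fun σ => {w | ¬ (G.Adj w (σ w) ∧ ¬ H.Adj w (σ w))}
  obtain ⟨σ₀, h₀⟩ := exists_perm_involutive_ne hV
  obtain ⟨σ, hσ, hmin⟩ := Finset.exists_min_image
    ({σ : Equiv.Perm V | (∀ w, σ (σ w) = w) ∧ ∀ w, σ w ≠ w} : Finset (Equiv.Perm V))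
    (fun σ => #(bad σ)) ⟨σ₀, by simpa using h₀⟩
  simp only [mem_filter, mem_univ, true_and] at hσ hmin
  obtain ⟨hinv, hne⟩ := hσ
  rcases (bad σ).eq_empty_or_nonempty with hbad | ⟨x, hx⟩
  · have hgood : ∀ w, G.Adj w (σ w) ∧ ¬ H.Adj w (σ w) := by
      intro w
      by_contra hw
      have : w ∈ bad σ := by simpa only [bad, mem_filter, mem_univ, true_and] using hw
      rw [hbad] at this
      simp at this
    refine ⟨σ, ?_⟩
    simp only [matchPerms, mem_filter, mem_univ, true_and, mul_zero, Finset.card_eq_zero]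
    refine ⟨hinv, fun w => (hgood w).1, Finset.eq_empty_of_forall_notMem fun w hw => ?_⟩
    exact (hgood w).2 (mem_onEdges.1 hw)
  · exfalso
    obtain ⟨z, hz⟩ : (({y | G.Adj (σ x) y} : Finset V) \
        ({x} ∪ ({y | H.Adj (σ x) y} : Finset V))).Nonempty := by
      rw [← Finset.card_pos]
      have h1 : #({y | H.Adj (σ x) y} : Finset V) ≤ 1 := by
        rw [Finset.card_le_one]
        intro a ha b hb
        simp only [mem_filter, mem_univ, true_and] at ha hb
        exact hH _ _ _ ha hb
      have h2 := Finset.card_union_le {x} ({y | H.Adj (σ x) y} : Finset V)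
      have h3 := Finset.le_card_sdiff ({x} ∪ ({y | H.Adj (σ x) y} : Finset V))
        ({y | G.Adj (σ x) y} : Finset V)
      rw [hd] at h3
      rw [Finset.card_singleton] at h2
      omega
    simp only [mem_sdiff, mem_filter, mem_univ, true_and, mem_union, mem_singleton, not_or] at hz
    obtain ⟨hzG, hzx, hzH⟩ := hz
    have hpos := (hest σ hinv hne ∅ (by simp) x z).2 hzx hzG.ne' (by simp)
    have hpos' : (0 : ℝ) < #{f ∈ walks G σ m x z | IsClean H ∅ σ f} :=
      lt_of_lt_of_le (mul_pos (by linarith) hD) hpos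
    obtain ⟨v, hv⟩ := Finset.card_pos.1 (Nat.cast_pos.1 hpos')
    obtain ⟨hvw, ⟨hinj, hdis⟩, hstepsH, -⟩ := mem_filter.1 hv
    obtain ⟨rfl, rfl, hsteps⟩ := (mem_filter.1 hvw).2
    have hG : ∀ i, G.Adj (v i) (σ (v (i + 1))) ∧ ¬ H.Adj (v i) (σ (v (i + 1))) :=
      forall_fin_cyclic (P := fun i j => G.Adj (v i) (σ (v j)) ∧ ¬ H.Adj (v i) (σ (v j)))
        (fun i => ⟨hsteps i, hstepsH i⟩) ⟨hzG.symm, fun h => hzH h.symm⟩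
    have hlt : #(bad (switch v σ)) < #(bad σ) := by
      refine Finset.card_lt_card ((Finset.ssubset_iff_of_subset ?_).2 ⟨v 0, hx, ?_⟩)
      · intro w hw
        simp only [bad, mem_filter, mem_univ, true_and] at hw ⊢
        rcases eq_or_eq_or_switch_eq hinv v w with ⟨i, rfl⟩ | ⟨i, rfl⟩ | ⟨-, -, h⟩
        · rw [switch_apply hinj hdis] at hw
          exact absurd (hG i) hw
        · rw [switch_apply_image hinj hdis hinv] at hw
          exact absurd ⟨(hG i).1.symm, fun h => (hG i).2 h.symm⟩ hw
        · rwa [h] at hw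
      · simp only [bad, mem_filter, mem_univ, true_and, not_not]
        rw [switch_apply hinj hdis]
        exact hG 0
    refine absurd (hmin (switch v σ) ⟨switch_switch_apply hinv, fun w hw => ?_⟩) (not_le.2 hlt)
    simp only [switch, Equiv.Perm.mul_apply, Equiv.Perm.inv_eq_iff_eq] at hw
    exact hne _ hw

end Existence

section Translation

variable {V : Type*} [Fintype V] [DecidableEq V]

/-- The set of edges `{v, σ v}`. -/
def permEdges (σ : Equiv.Perm V) : Finset (Sym2 V) :=
  univ.image fun v => s(v, σ v)

theorem mem_permEdges {σ : Equiv.Perm V} (hσ : ∀ w, σ (σ w) = w) (a b : V) :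
    s(a, b) ∈ permEdges σ ↔ σ a = b := by
  simp only [permEdges, mem_image, mem_univ, true_and, Sym2.eq_iff]
  constructor
  · rintro ⟨v, ⟨rfl, rfl⟩ | ⟨rfl, rfl⟩⟩
    · rfl
    · exact hσ v
  · rintro rfl
    exact ⟨a, Or.inl ⟨rfl, rfl⟩⟩

theorem isPM_permEdges {G : SimpleGraph V} {σ : Equiv.Perm V} (hσ : ∀ w, σ (σ w) = w)
    (hG : ∀ w, G.Adj w (σ w)) : IsPM G (permEdges σ) := by
  constructor
  · intro e he
    simp only [permEdges, mem_image, mem_univ, true_and] at he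
    obtain ⟨v, rfl⟩ := he
    exact hG v
  · intro v
    refine ⟨s(v, σ v), ⟨(mem_permEdges hσ _ _).2 rfl, Sym2.mem_mk_left _ _⟩, ?_⟩
    rintro e ⟨he, w, rfl⟩
    rw [(mem_permEdges hσ _ _).1 he]

theorem card_onEdges_eq {N : Finset (Sym2 V)} {σ : Equiv.Perm V}
    (hσ : ∀ w, σ (σ w) = w) (hne : ∀ w, σ w ≠ w) :
    #(onEdges (SimpleGraph.fromEdgeSet (N : Set (Sym2 V))) σ) = 2 * #(permEdges σ ∩ N) := by
  rw [Finset.card_eq_sum_card_fiberwise (f := fun v => s(v, σ v)) (t := permEdges σ ∩ N),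
    Finset.sum_const_nat (m := 2), mul_comm]
  · intro e he
    simp only [permEdges, mem_inter, mem_image, mem_univ, true_and] at he
    obtain ⟨⟨v, rfl⟩, hv⟩ := he
    rw [← Finset.card_pair (hne v).symm]
    congr 1
    ext w
    simp only [mem_filter, mem_onEdges, SimpleGraph.fromEdgeSet_adj, mem_coe, Sym2.eq_iff,
      mem_insert, mem_singleton]
    constructor
    · rintro ⟨-, ⟨h, -⟩ | ⟨h, -⟩⟩
      · exact Or.inl h
      · exact Or.inr h
    · rintro (rfl | rfl)
      · exact ⟨⟨hv, (hne w).symm⟩, Or.inl ⟨rfl, rfl⟩⟩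
      · exact ⟨⟨by rwa [hσ, Sym2.eq_swap], by rw [hσ]; exact hne v⟩, Or.inr ⟨rfl, hσ v⟩⟩
  · intro v hv
    simp only [mem_coe, mem_onEdges, SimpleGraph.fromEdgeSet_adj] at hv
    simp only [coe_inter, Set.mem_inter_iff, mem_coe]
    exact ⟨(mem_permEdges hσ _ _).2 rfl, hv.1⟩

theorem IsPM.exists_permEdges_eq {G : SimpleGraph V} {M : Finset (Sym2 V)} (hM : IsPM G M) :
    ∃ σ : Equiv.Perm V, (∀ w, σ (σ w) = w) ∧ (∀ w, G.Adj w (σ w)) ∧ permEdges σ = M := by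
  have h1 : ∀ v, ∃ w, s(v, w) ∈ M ∧ ∀ w', s(v, w') ∈ M → w' = w := by
    intro v
    obtain ⟨e, ⟨he, w, rfl⟩, huniq⟩ := hM.2 v
    refine ⟨w, he, fun w' hw' => ?_⟩
    exact Sym2.congr_right.1 (huniq _ ⟨hw', Sym2.mem_mk_left _ _⟩)
  choose g hg1 hg2 using h1
  have hg : Function.Involutive g := fun v => (hg2 _ v (by rw [Sym2.eq_swap]; exact hg1 v)).symm
  refine ⟨hg.toPerm, hg, fun w => hM.1 _ (hg1 w), ?_⟩
  ext e
  induction e using Sym2.ind with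
  | _ a b =>
    rw [mem_permEdges (σ := hg.toPerm) hg]
    constructor
    · rintro rfl
      exact hg1 a
    · intro h
      exact (hg2 a b h).symm

theorem pmCountInter_eq_card_matchPerms (G : SimpleGraph V) (N : Finset (Sym2 V)) (j : ℕ) :
    pmCountInter G N j = #(matchPerms G (SimpleGraph.fromEdgeSet (N : Set (Sym2 V))) j) := by
  rw [← Nat.card_eq_finsetCard, pmCountInter]
  symm
  have hmem : ∀ σ, σ ∈ matchPerms G (SimpleGraph.fromEdgeSet (N : Set (Sym2 V))) j ↔
      (∀ w, σ (σ w) = w) ∧ (∀ w, G.Adj w (σ w)) ∧ #(permEdges σ ∩ N) = j := by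
    intro σ
    simp only [matchPerms, mem_filter, mem_univ, true_and]
    refine and_congr_right fun h1 => and_congr_right fun h2 => ?_
    rw [card_onEdges_eq h1 fun w => (h2 w).ne']
    omega
  refine Nat.card_eq_of_bijective (fun σ => ⟨permEdges σ.1,
    isPM_permEdges ((hmem _).1 σ.2).1 ((hmem _).1 σ.2).2.1, ((hmem _).1 σ.2).2.2⟩) ⟨?_, ?_⟩
  · rintro ⟨σ, hσ⟩ ⟨τ, hτ⟩ h
    simp only [Subtype.mk.injEq] at h ⊢
    ext v
    have h1 : s(v, τ v) ∈ permEdges σ := by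
      rw [h]
      exact (mem_permEdges ((hmem _).1 hτ).1 _ _).2 rfl
    exact (mem_permEdges ((hmem _).1 hσ).1 _ _).1 h1
  · rintro ⟨M, hM, hj⟩
    obtain ⟨σ, h1, h2, rfl⟩ := hM.exists_permEdges_eq
    exact ⟨⟨σ, (hmem σ).2 ⟨h1, h2, hj⟩⟩, rfl⟩

open scoped Classical in
theorem card_adj_fromEdgeSet {G : SimpleGraph V} {N : Finset (Sym2 V)}
    (hN : ∀ e ∈ N, e ∈ G.edgeSet) :
    #{p : V × V | (SimpleGraph.fromEdgeSet (N : Set (Sym2 V))).Adj p.1 p.2} = 2 * #N := by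
  rw [Finset.card_eq_sum_card_fiberwise (f := fun p => s(p.1, p.2)) (t := N),
    Finset.sum_const_nat (m := 2), mul_comm]
  · intro e
    induction e using Sym2.ind with
    | _ a b =>
      intro he
      have hab : a ≠ b := (hN _ he).ne
      rw [← Finset.card_pair (a := (a, b)) (b := (b, a)) (by simp [hab])]
      congr 1
      ext ⟨x, y⟩
      simp only [mem_filter, mem_univ, true_and, SimpleGraph.fromEdgeSet_adj, mem_coe, Sym2.eq_iff,
        mem_insert, mem_singleton, Prod.mk.injEq]
      constructor
      · rintro ⟨-, h⟩
        exact h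
      · rintro (⟨rfl, rfl⟩ | ⟨rfl, rfl⟩)
        · exact ⟨⟨he, hab⟩, Or.inl ⟨rfl, rfl⟩⟩
        · exact ⟨⟨by rwa [Sym2.eq_swap], hab.symm⟩, Or.inr ⟨rfl, rfl⟩⟩
  · rintro ⟨x, y⟩ hp
    simp only [coe_filter, mem_univ, true_and, Set.mem_ofPred_eq, SimpleGraph.fromEdgeSet_adj,
      mem_coe] at hp
    exact hp.1

end Translation

theorem IsMatchingIn.fromEdgeSet_le {V : Type*} {G : SimpleGraph V} {N : Finset (Sym2 V)}
    (hN : IsMatchingIn G N) : SimpleGraph.fromEdgeSet (N : Set (Sym2 V)) ≤ G := by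
  intro a b hab
  rw [SimpleGraph.fromEdgeSet_adj] at hab
  exact hN.1 _ hab.1

theorem IsMatchingIn.eq_of_adj {V : Type*} {G : SimpleGraph V} {N : Finset (Sym2 V)}
    (hN : IsMatchingIn G N) (a b c : V)
    (hab : (SimpleGraph.fromEdgeSet (N : Set (Sym2 V))).Adj a b)
    (hac : (SimpleGraph.fromEdgeSet (N : Set (Sym2 V))).Adj a c) : b = c := by
  rw [SimpleGraph.fromEdgeSet_adj] at hab hac
  by_contra hbc
  exact hN.2 _ hab.1 _ hac.1 (fun h => hbc (Sym2.congr_right.1 h)) a (Sym2.mem_mk_left _ _)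
    (Sym2.mem_mk_left _ _)

open scoped Classical in
theorem RobustExpander.cleanWalkEstimate {V : Type*} [Fintype V] {G H : SimpleGraph V} {ν τ : ℝ}
    (h : RobustExpander G ν τ) (hν : 0 < ν) (hτ : 0 < τ) {d : ℕ} (hd0 : 0 < d)
    (hd : ∀ x, #{y | G.Adj x y} = d) (hτd : (τ + ν) * Fintype.card V ≤ d)
    (hH : ∀ a b c, H.Adj a b → H.Adj a c → b = c) {l q J : ℕ} (hl : 1 ≤ l * ν) (hq : 1 ≤ q)
    (hJ : 1 ≤ J) {ξ : ℝ}
    (hξ : (1 - ν ^ (l + 1)) ^ q * Fintype.card V +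
      4 * (((l + 2) * q : ℕ) + 1) ^ 2 * J * (Fintype.card V / d ^ 2) ≤ ξ) :
    CleanWalkEstimate G H ((l + 2) * q) J (d ^ ((l + 2) * q) / Fintype.card V) ξ := by
  refine cleanWalkEstimate_of_mixing hd0 hd hH ?_ hJ (fun σ x z => ?_) hξ
  · nlinarith
  · refine abs_card_walks_sub_le hd (fun x z => ?_) q x z
    refine le_trans ?_ (pow_le_card_walks h hν hτ hd hτd hl σ x z)
    have hn : (0 : ℝ) < Fintype.card V := by exact_mod_cast Fintype.card_pos_iff.2 ⟨x⟩
    have hdn : (d : ℝ) ≤ Fintype.card V := by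
      rw [← hd x]
      exact_mod_cast Finset.card_le_univ _
    rw [div_le_iff₀ hn, mul_pow, mul_assoc, ← pow_succ]
    gcongr

theorem ratio_bounds_of_mul_bounds {a b P k d θ : ℝ} (ha : 0 < a) (hb : 0 ≤ b) (hP : 0 ≤ P)
    (hk : 0 < k) (hd : 0 < d) (hθ : 0 ≤ θ) (hθ8 : θ ≤ 1 / 8) (hkd : 2 * k ≤ θ * d)
    (h1 : a * (P * (1 - θ)) ≤ b * (k * d * (1 + θ)))
    (h2 : b * (k * (d - 2 * k) * (1 - θ)) ≤ a * (P * (1 + θ))) :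
    (1 - 8 * θ) * (P / (k * d)) ≤ b / a ∧ b / a ≤ (1 + 8 * θ) * (P / (k * d)) := by
  have hQ : 0 < k * d := mul_pos hk hd
  have haP : 0 ≤ a * P := mul_nonneg ha.le hP
  constructor
  · rw [mul_div_assoc', div_le_div_iff₀ hQ ha]
    have h3 : (1 - 8 * θ) * (1 + θ) ≤ 1 - θ := by nlinarith
    have h4 := mul_le_mul_of_nonneg_left h3 haP
    refine le_of_mul_le_mul_right (a := 1 + θ) ?_ (by linarith)
    linarith
  · rw [mul_div_assoc', div_le_div_iff₀ ha hQ]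
    have h3 : 1 + θ ≤ (1 + 8 * θ) * (1 - θ) ^ 2 := by
      have : 0 ≤ θ * (5 - 15 * θ + 8 * θ ^ 2) :=
        mul_nonneg hθ (by nlinarith [sq_nonneg θ])
      nlinarith
    have h4 := mul_le_mul_of_nonneg_left h3 haP
    have h5 : b * (k * d) * (1 - θ) ^ 2 ≤ b * (k * (d - 2 * k) * (1 - θ)) := by
      have : b * k * (1 - θ) * (d * (1 - θ)) ≤ b * k * (1 - θ) * (d - 2 * k) :=
        mul_le_mul_of_nonneg_left (by linarith)
          (mul_nonneg (mul_nonneg hb hk.le) (by linarith))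
      linarith
    refine le_of_mul_le_mul_right (a := (1 - θ) ^ 2) ?_ (pow_pos (by linarith) 2)
    linarith

theorem eventually_log_sq_mul_rpow_le (A : ℝ) :
    ∀ᶠ x : ℝ in Filter.atTop,
      A * (Real.log x ^ 2 * x ^ (-(2 / 3) : ℝ)) ≤ x ^ (-(1 / 7) : ℝ) / 8 := by
  have hA : 0 < 8 * (|A| + 1) := by positivity
  have h := (isLittleO_log_rpow_rpow_atTop (s := 11 / 21) 2 (by norm_num)).bound (inv_pos.2 hA)
  filter_upwards [h, Filter.eventually_gt_atTop 0] with x hx hx0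
  rw [Real.rpow_two, Real.norm_of_nonneg (sq_nonneg _),
    Real.norm_of_nonneg (Real.rpow_nonneg hx0.le _)] at hx
  have h1 : Real.log x ^ 2 * x ^ (-(2 / 3) : ℝ) ≤ (8 * (|A| + 1))⁻¹ * x ^ (-(1 / 7) : ℝ) := by
    have h2 : x ^ (-(1 / 7) : ℝ) = x ^ (11 / 21 : ℝ) * x ^ (-(2 / 3) : ℝ) := by
      rw [← Real.rpow_add hx0]
      norm_num
    rw [h2, ← mul_assoc]
    exact mul_le_mul_of_nonneg_right hx (Real.rpow_nonneg hx0.le _)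
  calc A * (Real.log x ^ 2 * x ^ (-(2 / 3) : ℝ))
      ≤ (|A| + 1) * (Real.log x ^ 2 * x ^ (-(2 / 3) : ℝ)) :=
        mul_le_mul_of_nonneg_right (by linarith [le_abs_self A]) (by positivity)
    _ ≤ (|A| + 1) * ((8 * (|A| + 1))⁻¹ * x ^ (-(1 / 7) : ℝ)) :=
        mul_le_mul_of_nonneg_left h1 (by positivity)
    _ = x ^ (-(1 / 7) : ℝ) / 8 := by
        field_simp

theorem one_sub_pow_mul_le_inv {η x : ℝ} (hη : 0 < η) (hη1 : η ≤ 1) (hx : 0 < x) {q : ℕ}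
    (hq : 2 / η * Real.log x ≤ q) : (1 - η) ^ q * x ≤ x⁻¹ := by
  have h1 : (1 - η) ^ q ≤ Real.exp (-2 * Real.log x) := by
    calc (1 - η) ^ q ≤ Real.exp (-η) ^ q :=
          pow_le_pow_left₀ (by linarith) (Real.one_sub_le_exp_neg η) q
      _ = Real.exp (q * -η) := (Real.exp_nat_mul _ _).symm
      _ ≤ Real.exp (-2 * Real.log x) := by
          refine Real.exp_le_exp.2 ?_
          have h2 := mul_le_mul_of_nonneg_right hq hη.le
          have h3 : 2 / η * Real.log x * η = 2 * Real.log x := by field_simp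
          linarith
  have h4 : Real.exp (-2 * Real.log x) = x⁻¹ * x⁻¹ := by
    rw [show -2 * Real.log x = -Real.log x + -Real.log x by ring, Real.exp_add, Real.exp_neg,
      Real.exp_log hx]
  rw [h4] at h1
  calc (1 - η) ^ q * x ≤ x⁻¹ * x⁻¹ * x := mul_le_mul_of_nonneg_right h1 hx.le
    _ = x⁻¹ := by field_simp

/-- The error of the walk counts for walks of length of order `log x`, in terms of the number `x`
of vertices. -/
theorem eventually_exists_length {δ η : ℝ} (hδ : 0 < δ) (hη : 0 < η) (hη1 : η ≤ 1) (L : ℕ) :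
    ∀ᶠ x : ℝ in Filter.atTop, ∃ q : ℕ, 1 ≤ q ∧ ∀ J : ℝ, J ≤ 2 * x ^ (1 / 3 : ℝ) →
      (1 - η) ^ q * x + 4 * ((L * q : ℕ) + 1) ^ 2 * J * (x / (δ * x) ^ 2) ≤
        x ^ (-(1 / 7) : ℝ) / 8 := by
  set C : ℝ := L * (2 / η + 1) + 1 with hC
  have hC0 : 0 ≤ C := by positivity
  filter_upwards [eventually_log_sq_mul_rpow_le (1 + 8 * C ^ 2 / δ ^ 2),
    Filter.eventually_gt_atTop 1, Filter.eventually_ge_atTop (Real.exp 1)] with x hx hx1 hxe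
  have hx0 : 0 < x := by linarith
  have hlog : 1 ≤ Real.log x := by
    rwa [Real.le_log_iff_exp_le hx0]
  have hpos : 0 < 2 / η * Real.log x := by positivity
  refine ⟨⌈2 / η * Real.log x⌉₊, Nat.ceil_pos.2 hpos, fun J hJ => ?_⟩
  set q := ⌈2 / η * Real.log x⌉₊
  have h1 : (1 - η) ^ q * x ≤ x⁻¹ := one_sub_pow_mul_le_inv hη hη1 hx0 (Nat.le_ceil _)
  have hq : (q : ℝ) ≤ (2 / η + 1) * Real.log x := by
    have := (Nat.ceil_lt_add_one hpos.le).le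
    change (q : ℝ) ≤ _ at this
    linarith
  have hm : ((L * q : ℕ) : ℝ) + 1 ≤ C * Real.log x := by
    push_cast
    have := mul_le_mul_of_nonneg_left hq (Nat.cast_nonneg (α := ℝ) L)
    rw [hC]
    linarith
  have h2 : x⁻¹ ≤ Real.log x ^ 2 * x ^ (-(2 / 3) : ℝ) := by
    rw [← Real.rpow_neg_one]
    have h3 : x ^ (-1 : ℝ) ≤ x ^ (-(2 / 3) : ℝ) :=
      Real.rpow_le_rpow_of_exponent_le hx1.le (by norm_num)
    refine h3.trans (le_mul_of_one_le_left (Real.rpow_nonneg hx0.le _) ?_)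
    exact one_le_pow₀ hlog
  have h4 : x ^ (1 / 3 : ℝ) * (x / (δ * x) ^ 2) = x ^ (-(2 / 3) : ℝ) / δ ^ 2 := by
    have h5 : x ^ (-(2 / 3) : ℝ) = x ^ (1 / 3 : ℝ) * x⁻¹ := by
      rw [← Real.rpow_neg_one, ← Real.rpow_add hx0]
      norm_num
    rw [h5]
    field_simp
  calc (1 - η) ^ q * x + 4 * ((L * q : ℕ) + 1) ^ 2 * J * (x / (δ * x) ^ 2)
      ≤ Real.log x ^ 2 * x ^ (-(2 / 3) : ℝ) +
        4 * (C * Real.log x) ^ 2 * (2 * x ^ (1 / 3 : ℝ)) * (x / (δ * x) ^ 2) := by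
        refine add_le_add (h1.trans h2) (mul_le_mul_of_nonneg_right ?_ (by positivity))
        refine (mul_le_mul_of_nonneg_left hJ (by positivity)).trans
          (mul_le_mul_of_nonneg_right ?_ (by positivity))
        gcongr
    _ = Real.log x ^ 2 * x ^ (-(2 / 3) : ℝ) +
        8 * C ^ 2 * Real.log x ^ 2 * (x ^ (1 / 3 : ℝ) * (x / (δ * x) ^ 2)) := by ring
    _ = (1 + 8 * C ^ 2 / δ ^ 2) * (Real.log x ^ 2 * x ^ (-(2 / 3) : ℝ)) := by
        rw [h4]
        ring
    _ ≤ _ := hx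

theorem eventually_two_mul_rpow_le {δ : ℝ} (hδ : 0 < δ) :
    ∀ᶠ x : ℝ in Filter.atTop, 2 * x ^ (1 / 3 : ℝ) ≤ x ^ (-(1 / 7) : ℝ) / 8 * (δ * x) := by
  filter_upwards [eventually_log_sq_mul_rpow_le (2 / δ), Filter.eventually_gt_atTop 0,
    Filter.eventually_ge_atTop (Real.exp 1)] with x hx hx0 hxe
  have hlog : 1 ≤ Real.log x := by
    rwa [Real.le_log_iff_exp_le hx0]
  have h1 : x ^ (1 / 3 : ℝ) = x ^ (-(2 / 3) : ℝ) * x := by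
    rw [← Real.rpow_add_one hx0.ne']
    norm_num
  have h2 : x ^ (-(2 / 3) : ℝ) ≤ Real.log x ^ 2 * x ^ (-(2 / 3) : ℝ) :=
    le_mul_of_one_le_left (Real.rpow_nonneg hx0.le _) (one_le_pow₀ hlog)
  calc 2 * x ^ (1 / 3 : ℝ) = 2 / δ * x ^ (-(2 / 3) : ℝ) * (δ * x) := by
        rw [h1]
        field_simp
    _ ≤ x ^ (-(1 / 7) : ℝ) / 8 * (δ * x) := by
        refine mul_le_mul_of_nonneg_right (le_trans ?_ hx) (by positivity)
        exact mul_le_mul_of_nonneg_left h2 (by positivity)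

open scoped Classical in
theorem matchPerms_nonempty {V : Type*} [Fintype V] {G H : SimpleGraph V}
    (hV : Even (Fintype.card V)) (hHG : H ≤ G) {d : ℕ} (hd : ∀ x, #{y | G.Adj x y} = d)
    (hd3 : 3 ≤ d) (hH : ∀ a b c, H.Adj a b → H.Adj a c → b = c)
    {s : ℕ} (hs : #{p : V × V | H.Adj p.1 p.2} = 2 * s) {m J : ℕ} {D ξ : ℝ} (hD : 0 < D)
    (hξ : 0 ≤ ξ) (hξ1 : ξ < 1) (hest : CleanWalkEstimate G H m J D ξ) {k : ℕ} (hkJ : 2 * k ≤ J)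
    (hks : k ≤ s) : (matchPerms G H k).Nonempty := by
  induction k with
  | zero => exact matchPerms_zero_nonempty hV hd hd3 hH hD hξ1 hest
  | succ k ih =>
    have h1 := (matchPerms_ratio_bounds hHG hd hH hs hD hξ hξ1.le hest hkJ).1
    have h2 : (0 : ℝ) < #(matchPerms G H k) := by
      exact_mod_cast (ih (by omega) (by omega)).card_pos
    have h3 : (0 : ℝ) < s - k := by
      have : (k : ℝ) < s := by exact_mod_cast hks
      linarith
    have h4 := (mul_pos h2 (mul_pos h3 (sub_pos.2 hξ1))).trans_le h1
    rw [← Finset.card_pos]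
    exact_mod_cast pos_of_mul_pos_left h4 (by positivity)

/-- ratio estimate, matching case. -/
theorem ratio_estimate_matching :
    ∀ δ : ℝ, 0 < δ → δ ≤ 1 →
    ∃ τ₀ : ℝ, 0 < τ₀ ∧
    ∀ τ ν : ℝ, 0 < ν → ν ≤ τ → τ ≤ τ₀ →
    ∃ n₀ : ℕ, ∀ n : ℕ, n₀ ≤ n → Even n →
    ∀ (V : Type) [Fintype V] [DecidableEq V], Fintype.card V = n →
    ∀ G : SimpleGraph V,
      (∀ v : V, (Nat.card {u : V | G.Adj v u} : ℝ) = δ * (n : ℝ)) →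
      RobustExpander G ν τ →
    ∀ N : Finset (Sym2 V), IsMatchingIn G N →
    ∀ k : ℕ, 1 ≤ k →
      (k : ℝ) ≤ min (N.card : ℝ) ((n : ℝ) ^ ((1 : ℝ) / 3)) →
      pmCountInter G N (k - 1) ≠ 0 ∧
      (1 - (n : ℝ) ^ (-(1 / 7) : ℝ)) * (((N.card : ℝ) - (k : ℝ) + 1) / ((k : ℝ) * δ * (n : ℝ))) ≤
        (pmCountInter G N k : ℝ) / (pmCountInter G N (k - 1) : ℝ) ∧
      (pmCountInter G N k : ℝ) / (pmCountInter G N (k - 1) : ℝ) ≤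
        (1 + (n : ℝ) ^ (-(1 / 7) : ℝ)) * (((N.card : ℝ) - (k : ℝ) + 1) / ((k : ℝ) * δ * (n : ℝ))) := by
  classical
  intro δ hδ hδ1
  refine ⟨δ / 2, by positivity, fun τ ν hν hντ hττ₀ => ?_⟩
  set l := ⌈1 / ν⌉₊ with hl_def
  have hl : 1 ≤ l * ν := (div_le_iff₀ hν).1 (Nat.le_ceil _)
  have hν1 : ν ≤ 1 := by linarith
  have hlarge := tendsto_natCast_atTop_atTop (R := ℝ) |>.eventually <|
    (eventually_exists_length hδ (pow_pos hν (l + 1)) (pow_le_one₀ hν.le hν1) (l + 2)).and <|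
      (eventually_two_mul_rpow_le hδ).and <| (Filter.eventually_ge_atTop 1).and <|
        Filter.eventually_ge_atTop (3 / δ)
  obtain ⟨n₀, hn₀⟩ := Filter.eventually_atTop.1 hlarge
  refine ⟨n₀, ?_⟩
  intro n hn hn_even V _ _ hVn G hdeg hexp N hN k hk hkN
  obtain ⟨⟨q, hq, hmix⟩, hkd, hn1, hn3⟩ := hn₀ n hn
  obtain ⟨hkN, hkn⟩ := le_min_iff.1 hkN
  obtain ⟨k, rfl⟩ : ∃ j, k = j + 1 := ⟨k - 1, by omega⟩
  have hn0 : (0 : ℝ) < n := by linarith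
  obtain ⟨v₀⟩ : Nonempty V := Fintype.card_pos_iff.1 (by rw [hVn]; exact_mod_cast hn0)
  set d := Nat.card {u : V | G.Adj v₀ u} with hd_def
  have hdn : (d : ℝ) = δ * n := hdeg v₀
  have hd : ∀ x, #{y | G.Adj x y} = d := by
    intro x
    have h1 : Nat.card {u : V | G.Adj x u} = d := by
      exact_mod_cast (hdeg x).trans hdn.symm
    rw [← h1, Nat.card_eq_fintype_card, ← Set.toFinset_card]
    congr 1
    ext y
    simp
  have hd3 : 3 ≤ d := by
    have h1 := (div_le_iff₀ hδ).1 hn3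
    have : (3 : ℝ) ≤ d := by linarith
    exact_mod_cast this
  set θ : ℝ := (n : ℝ) ^ (-(1 / 7) : ℝ) / 8 with hθ_def
  have hθ0 : 0 ≤ θ := by positivity
  have hθ8 : θ ≤ 1 / 8 := by
    have := Real.rpow_le_one_of_one_le_of_nonpos hn1 (show (-(1 / 7) : ℝ) ≤ 0 by norm_num)
    linarith
  have hHG := hN.fromEdgeSet_le
  have hH := hN.eq_of_adj
  have hs := card_adj_fromEdgeSet hN.1
  rw [Nat.add_sub_cancel, pmCountInter_eq_card_matchPerms, pmCountInter_eq_card_matchPerms]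
  set H := SimpleGraph.fromEdgeSet (N : Set (Sym2 V))
  have hest : CleanWalkEstimate G H ((l + 2) * q) (2 * (k + 1))
      (d ^ ((l + 2) * q) / Fintype.card V) θ := by
    refine hexp.cleanWalkEstimate hν (hν.trans_le hντ) (by omega) hd ?_ hH hl hq (by omega) ?_
    · rw [hVn, hdn]
      exact mul_le_mul_of_nonneg_right (by linarith) hn0.le
    · rw [hVn, hdn]
      refine hmix _ ?_
      push_cast at hkn ⊢
      linarith
  have hd0 : (0 : ℝ) < d := by rw [hdn]; positivity
  have hD : (0 : ℝ) < d ^ ((l + 2) * q) / Fintype.card V := by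
    rw [hVn]
    positivity
  have hkN' : k + 1 ≤ #N := by exact_mod_cast hkN
  have hne := matchPerms_nonempty (by rwa [hVn]) hHG hd hd3 hH (s := #N) (by convert hs) hD hθ0
    (by linarith) hest (k := k) (by omega) (by omega)
  obtain ⟨h1, h2⟩ := matchPerms_ratio_bounds (k := k) hHG hd hH (s := #N) (by convert hs) hD hθ0
    (by linarith) hest le_rfl
  refine ⟨hne.card_pos.ne', ?_⟩
  have hkN'' : (0 : ℝ) ≤ #N - k := by
    push_cast at hkN
    linarith
  have h := ratio_bounds_of_mul_bounds (by exact_mod_cast hne.card_pos) (Nat.cast_nonneg _) hkN''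
    (Nat.cast_add_one_pos k) hd0 hθ0 hθ8 ?_ h1 h2
  · have e1 : 8 * θ = (n : ℝ) ^ (-(1 / 7) : ℝ) := by
      rw [hθ_def]
      ring
    have e2 : (#N : ℝ) - (k + 1 : ℕ) + 1 = #N - k := by
      push_cast
      ring
    have e3 : ((k + 1 : ℕ) : ℝ) * δ * n = (k + 1) * d := by
      rw [hdn]
      push_cast
      ring
    rw [e2, e3, ← e1]
    exact h
  · push_cast at hkn
    rw [hdn]
    linarith

end RPM
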